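/- arXiv:1010.0590 — 2 statements merged into one kernel-verified Lean document; each statement's English description precedes it below -/
import Mathlib

section
/- Asymptotic formula: let X be a Hadamard space, let (μ_t)_{t≥0} and (σ_t)_{t≥0} be geodesic rays in W₂(X), let μ and σ be any displacement interpolations of these rays, and let μ_∞, σ_∞ be the corresponding asymptotic measures on c∂X. Then (μ_t) and (σ_t) are asymptotic (stay at bounded Wasserstein distance) if and only if μ_∞ = σ_∞, and lim_{t→∞} W(μ_t,σ_t)/t = W_∞(μ_∞,σ_∞), where W_∞ is the Wasserstein metric on measures on c∂X built from the cost d_∞². -/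
open MeasureTheory Filter Set Topology
open scoped NNReal ENNReal

noncomputable section


/-! ## Geodesics and Hadamard spaces -/

/-- `γ` is a geodesic on the set of parameters `s`, of speed `v`, with respect to the
distance function `d`. -/
def IsGeodesicOnWith {A : Type*} (d : A → A → ℝ) (γ : ℝ → A) (s : Set ℝ) (v : ℝ) : Prop :=
  ∀ t ∈ s, ∀ t' ∈ s, d (γ t) (γ t') = v * |t - t'|

/-- A metric space is geodesic if any two points are joined by a geodesic. -/
def IsGeodesicSpace (Y : Type*) [MetricSpace Y] : Prop :=
  ∀ x y : Y, ∃ γ : ℝ → Y, γ 0 = x ∧ γ 1 = y ∧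
    IsGeodesicOnWith dist γ (Set.Icc (0:ℝ) 1) (dist x y)

/-- Every geodesic segment extends to a complete geodesic (defined on all of `ℝ`). -/
def GeodesicallyComplete (Y : Type*) [MetricSpace Y] : Prop :=
  ∀ (γ : ℝ → Y) (a b v : ℝ), a < b → IsGeodesicOnWith dist γ (Set.Icc a b) v →
    ∃ g : ℝ → Y, IsGeodesicOnWith dist g Set.univ v ∧ ∀ t ∈ Set.Icc a b, g t = γ t

/-- A Hadamard space: complete, separable, locally compact, geodesic, globally CAT(0).
The CAT(0) comparison inequality is expressed through the explicit formula for the distance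
from a vertex to a point of the opposite side in the Euclidean comparison triangle. -/
structure IsHadamard (X : Type*) [MetricSpace X] : Prop where
  complete : CompleteSpace X
  separable : TopologicalSpace.SeparableSpace X
  locallyCompact : LocallyCompactSpace X
  geodesic : IsGeodesicSpace X
  cat0 : ∀ (x y z : X) (γ : ℝ → X), γ 0 = y → γ 1 = z →
    IsGeodesicOnWith dist γ (Set.Icc (0:ℝ) 1) (dist y z) →
    ∀ t ∈ Set.Icc (0:ℝ) 1,
      dist x (γ t) ^ 2 ≤ (1 - t) * dist x y ^ 2 + t * dist x z ^ 2 - t * (1 - t) * dist y z ^ 2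

/-- A space is non-branching if two geodesics coinciding on a nonempty open set of parameters
coincide on their whole common interval of definition. -/
def NonBranching (X : Type*) [MetricSpace X] : Prop :=
  ∀ (γ β : ℝ → X) (I : Set ℝ) (v w : ℝ),
    IsGeodesicOnWith dist γ I v → IsGeodesicOnWith dist β I w →
    (∃ U : Set ℝ, U ⊆ I ∧ IsOpen U ∧ U.Nonempty ∧ ∀ t ∈ U, γ t = β t) →
    ∀ t ∈ I, γ t = β t

/-! ## The Wasserstein space -/

/-- `π` is a coupling (transport plan) between `μ` and `ν`. -/
def IsCoupling {A B : Type*} [MeasurableSpace A] [MeasurableSpace B]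
    (π : Measure (A × B)) (μ : Measure A) (ν : Measure B) : Prop :=
  π.map Prod.fst = μ ∧ π.map Prod.snd = ν

/-- The quadratic Wasserstein space over `Y`: Borel probability measures with finite second
moment. -/
abbrev W2Space (Y : Type*) [MetricSpace Y] [MeasurableSpace Y] : Type _ :=
  {μ : Measure Y // IsProbabilityMeasure μ ∧
    ∃ x₀ : Y, (∫⁻ x, ENNReal.ofReal (dist x₀ x) ^ 2 ∂μ) < ⊤}

/-- The quadratic transport cost between two measures. -/
def W2cost {Y : Type*} [MetricSpace Y] [MeasurableSpace Y] (μ ν : Measure Y) : ℝ≥0∞ :=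
  ⨅ (π : Measure (Y × Y)) (_ : IsCoupling π μ ν),
    ∫⁻ p, ENNReal.ofReal (dist p.1 p.2) ^ 2 ∂π

/-- The quadratic Wasserstein distance. -/
def Wdist {Y : Type*} [MetricSpace Y] [MeasurableSpace Y] (μ ν : W2Space Y) : ℝ :=
  Real.sqrt (W2cost μ.1 ν.1).toReal


/-! ## Rays, complete geodesics, the boundary at infinity and the cone over it -/

/-- Geodesic rays of `X` (arbitrary nonnegative speed), parametrized by `ℝ≥0`.
The topology (of a subtype of a product) coincides on this set with the topology of
uniform convergence on compact sets. -/
abbrev RaySpace (X : Type*) [MetricSpace X] : Type _ :=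
  {γ : ℝ≥0 → X // ∃ v : ℝ, 0 ≤ v ∧ ∀ s t : ℝ≥0, dist (γ s) (γ t) = v * dist s t}

/-- Unit speed geodesic rays of `X`. -/
abbrev UnitRay (X : Type*) [MetricSpace X] : Type _ :=
  {γ : ℝ≥0 → X // ∀ s t : ℝ≥0, dist (γ s) (γ t) = dist s t}

/-- Complete geodesics of `X` (arbitrary nonnegative speed). -/
abbrev GeoLine (X : Type*) [MetricSpace X] : Type _ :=
  {γ : ℝ → X // ∃ v : ℝ, 0 ≤ v ∧ ∀ s t : ℝ, dist (γ s) (γ t) = v * |s - t|}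

/-- Complete unit speed geodesics of `X`. -/
abbrev UnitLine (X : Type*) [MetricSpace X] : Type _ :=
  {γ : ℝ → X // ∀ s t : ℝ, dist (γ s) (γ t) = |s - t|}

/-- Evaluation of a ray at time `t`. -/
def rayEval {X : Type*} [MetricSpace X] (t : ℝ≥0) : RaySpace X → X := fun γ => γ.1 t

/-- Two curves (w.r.t. a distance function `d`) are asymptotic if they stay at bounded
distance. -/
def AsymptoticMaps {A : Type*} (d : A → A → ℝ) (γ β : ℝ≥0 → A) : Prop :=
  ∃ C : ℝ, ∀ t, d (γ t) (β t) ≤ C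

/-- The asymptote relation on unit-speed rays. -/
def unitRaySetoid (X : Type*) [MetricSpace X] : Setoid (UnitRay X) where
  r γ β := AsymptoticMaps dist γ.1 β.1
  iseqv := by
    refine ⟨fun γ => ⟨0, fun t => by simp⟩, ?_, ?_⟩
    · rintro γ β ⟨C, h⟩
      exact ⟨C, fun t => by rw [dist_comm]; exact h t⟩
    · rintro γ β δ ⟨C, h⟩ ⟨C', h'⟩
      exact ⟨C + C', fun t => (dist_triangle _ _ _).trans (add_le_add (h t) (h' t))⟩

/-- The geodesic boundary of `X`: asymptote classes of unit-speed rays, with the quotient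
topology of the topology of uniform convergence on compact sets (the cone topology). -/
abbrev Boundary (X : Type*) [MetricSpace X] := Quotient (unitRaySetoid X)

/-- Apex-like points, to be collapsed when forming the cone over `B`. -/
def coneIsApex {B : Type*} : B × ℝ≥0 ⊕ Unit → Prop
  | Sum.inl p => p.2 = 0
  | Sum.inr _ => True

/-- The relation collapsing all apex-like points. -/
def coneSetoid (B : Type*) : Setoid (B × ℝ≥0 ⊕ Unit) where
  r p q := p = q ∨ (coneIsApex p ∧ coneIsApex q)
  iseqv := by
    refine ⟨fun p => Or.inl rfl, ?_, ?_⟩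
    · rintro p q (rfl | h)
      · exact Or.inl rfl
      · exact Or.inr ⟨h.2, h.1⟩
    · rintro p q r (rfl | h) (rfl | h')
      · exact Or.inl rfl
      · exact Or.inr h'
      · exact Or.inr h
      · exact Or.inr ⟨h.1, h'.2⟩

/-- The cone over a space `B`: the quotient of `B × [0,∞)` collapsing the zero level to the
apex, with the quotient topology. -/
abbrev Cone (B : Type*) := Quotient (coneSetoid B)

/-- The point of the cone over `b` at height (speed) `s`. -/
def coneMk {B : Type*} (b : B) (s : ℝ≥0) : Cone B :=
  Quotient.mk (coneSetoid B) (Sum.inl (b, s))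

/-- The apex of the cone. -/
def conePt (B : Type*) : Cone B := Quotient.mk (coneSetoid B) (Sum.inr ())

private def coneSpeedAux {B : Type*} : B × ℝ≥0 ⊕ Unit → ℝ≥0
  | Sum.inl p => p.2
  | Sum.inr _ => 0

/-- The speed (radial) coordinate of a point of the cone. -/
def coneSpeed {B : Type*} : Cone B → ℝ≥0 :=
  Quotient.lift coneSpeedAux (by
    rintro p q (rfl | ⟨h1, h2⟩)
    · rfl
    · cases p <;> cases q <;> simp_all [coneIsApex, coneSpeedAux])

/-- The speed of a geodesic ray. -/
def raySpeed {X : Type*} [MetricSpace X] (γ : RaySpace X) : ℝ≥0 :=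
  nndist (γ.1 0) (γ.1 1)

lemma raySpeed_eq {X : Type*} [MetricSpace X] (γ : RaySpace X) {v : ℝ} (hv0 : 0 ≤ v)
    (hv : ∀ s t : ℝ≥0, dist (γ.1 s) (γ.1 t) = v * dist s t) : (raySpeed γ : ℝ) = v := by
  have h1 := hv 0 1
  have h2 : dist (0 : ℝ≥0) (1 : ℝ≥0) = 1 := by rw [NNReal.dist_eq]; norm_num
  rw [h2, mul_one] at h1
  rw [show (raySpeed γ : ℝ) = dist (γ.1 0) (γ.1 1) from (dist_nndist _ _).symm, h1]

/-- The unit reparametrization of a nonconstant ray. -/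
def rayUnit {X : Type*} [MetricSpace X] (γ : RaySpace X) (h : raySpeed γ ≠ 0) : UnitRay X := by
  refine ⟨fun t => γ.1 (t / raySpeed γ), ?_⟩
  obtain ⟨v, hv0, hv⟩ := γ.2
  have hveq : (raySpeed γ : ℝ) = v := raySpeed_eq γ hv0 hv
  intro s t
  have hr : (raySpeed γ : ℝ) ≠ 0 := by
    simpa using h
  show dist (γ.1 (s / raySpeed γ)) (γ.1 (t / raySpeed γ)) = dist s t
  rw [hv, NNReal.dist_eq, NNReal.dist_eq, NNReal.coe_div, NNReal.coe_div,
    div_sub_div_same, abs_div, abs_of_nonneg (raySpeed γ).coe_nonneg, ← hveq]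
  field_simp

/-- The point at infinity (in the cone over the boundary) defined by a geodesic ray:
its asymptote class together with its speed; constant rays are sent to the apex. -/
def rayEnd {X : Type*} [MetricSpace X] (γ : RaySpace X) : Cone (Boundary X) :=
  if h : raySpeed γ = 0 then conePt (Boundary X)
  else coneMk (Quotient.mk (unitRaySetoid X) (rayUnit γ h)) (raySpeed γ)

/-! ## Asymptotic distance -/

def dInfty {X : Type*} [MetricSpace X] (γ β : ℝ≥0 → X) : ℝ :=
  Filter.limsup (fun t : ℝ≥0 => dist (γ t) (β t) / (t : ℝ)) Filter.atTop

/-- The asymptotic (angular) distance on the boundary, computed on representative rays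
(it does not depend on the choice of representatives). -/
def boundaryDist {X : Type*} [MetricSpace X] (ξ ζ : Boundary X) : ℝ :=
  dInfty (ξ.out).1 (ζ.out).1

def coneDistAux {X : Type*} [MetricSpace X] :
    Boundary X × ℝ≥0 ⊕ Unit → Boundary X × ℝ≥0 ⊕ Unit → ℝ
  | Sum.inl p, Sum.inl q =>
      Real.sqrt (((p.2 : ℝ) - (q.2 : ℝ)) ^ 2 + (p.2 : ℝ) * (q.2 : ℝ) * boundaryDist p.1 q.1 ^ 2)
  | Sum.inl p, Sum.inr _ => p.2
  | Sum.inr _, Sum.inl q => q.2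
  | Sum.inr _, Sum.inr _ => 0

/-- The asymptotic distance on the cone over the boundary (the cone metric). -/
def coneDist {X : Type*} [MetricSpace X] : Cone (Boundary X) → Cone (Boundary X) → ℝ :=
  Quotient.lift₂ coneDistAux (by
    rintro a₁ a₂ b₁ b₂ h12 h34
    rcases h12 with rfl | ⟨h1, h2⟩ <;> rcases h34 with rfl | ⟨h3, h4⟩
    · rfl
    · rcases a₁ with p | u <;> rcases a₂ with q | v <;> rcases b₂ with q' | w <;>
        simp_all [coneIsApex, coneDistAux, Real.sqrt_sq, NNReal.coe_nonneg]
    · rcases a₂ with q | u <;> rcases a₁ with p | v <;> rcases b₁ with p' | w <;>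
        simp_all [coneIsApex, coneDistAux, Real.sqrt_sq, NNReal.coe_nonneg]
    · rcases a₁ with p | u <;> rcases a₂ with q | v <;> rcases b₁ with p' | w <;>
        rcases b₂ with q' | w' <;>
        simp_all [coneIsApex, coneDistAux, Real.sqrt_sq, NNReal.coe_nonneg])


-- Borel measurable structure on the boundary and the cone over it.
instance (X : Type*) [MetricSpace X] : MeasurableSpace (Boundary X) := borel _
instance (X : Type*) [MetricSpace X] : BorelSpace (Boundary X) := ⟨rfl⟩
instance (X : Type*) [MetricSpace X] : MeasurableSpace (Cone (Boundary X)) := borel _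
instance (X : Type*) [MetricSpace X] : BorelSpace (Cone (Boundary X)) := ⟨rfl⟩

/-- The Wasserstein metric `W_∞` on measures on the cone over the boundary, built from the
cost `d_∞²`. -/
def Winfty {X : Type*} [MetricSpace X] (m m' : Measure (Cone (Boundary X))) : ℝ :=
  Real.sqrt (⨅ (π : Measure (Cone (Boundary X) × Cone (Boundary X)))
    (_ : IsCoupling π m m'),
      ∫⁻ p, ENNReal.ofReal (coneDist p.1 p.2) ^ 2 ∂π).toReal


/-! ## Visibility -/

/-- `X` is a visibility space: any two distinct boundary points are the two endpoints of a
complete geodesic. -/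
def IsVisibility (X : Type*) [MetricSpace X] : Prop :=
  ∀ α ω : UnitRay X, ¬ AsymptoticMaps dist α.1 ω.1 →
    ∃ g : ℝ → X, (∀ s t : ℝ, dist (g s) (g t) = |s - t|) ∧
      AsymptoticMaps dist (fun t : ℝ≥0 => g (-(t : ℝ))) α.1 ∧
      AsymptoticMaps dist (fun t : ℝ≥0 => g (t : ℝ)) ω.1

/-! ## Curves, length, rectifiability -/

/-- The length of a curve with respect to a distance function `d`, as a supremum over
finite monotone sequences of parameters in `[a,b]`. -/
def curveLengthWith {A : Type*} (d : A → A → ℝ) (c : ℝ → A) (a b : ℝ) : ℝ≥0∞ :=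
  ⨆ (n : ℕ) (t : Fin (n + 1) → ℝ) (_ : Monotone t) (_ : ∀ i, t i ∈ Set.Icc a b),
    ∑ i : Fin n, ENNReal.ofReal (d (c (t i.castSucc)) (c (t i.succ)))

/-- Continuity of a curve with respect to a distance function `d`, on a set of parameters. -/
def ContinuousWithRespect {A : Type*} (d : A → A → ℝ) (c : ℝ → A) (s : Set ℝ) : Prop :=
  ∀ t ∈ s, ∀ ε : ℝ, 0 < ε → ∃ δ : ℝ, 0 < δ ∧ ∀ u ∈ s, |u - t| < δ → d (c u) (c t) < ε

/-- `W_∞` between measures on the boundary, viewed as the level `{speed = 1}` of the cone,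
with cost `d_∞²`. -/
def WinftyLevel1 {X : Type*} [MetricSpace X] (m m' : Measure (Boundary X)) : ℝ :=
  Real.sqrt (⨅ (π : Measure (Boundary X × Boundary X)) (_ : IsCoupling π m m'),
    ∫⁻ p, ENNReal.ofReal (coneDist (coneMk p.1 1) (coneMk p.2 1)) ^ 2 ∂π).toReal

/-! ## Support of a measure -/

/-- The (topological) support of a measure. -/
def msupport {A : Type*} [TopologicalSpace A] [MeasurableSpace A] (μ : Measure A) : Set A :=
  {x | ∀ U : Set A, x ∈ U → IsOpen U → 0 < μ U}

/-! ## Cyclical monotonicity and antagonism -/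

/-- A set `Γ` is `c`-cyclically monotone if no cyclic permutation of the target points of a
finite family of pairs of `Γ` decreases the total cost. -/
def CyclicallyMonotone {A : Type*} (c : A → A → ℝ) (Γ : Set (A × A)) : Prop :=
  ∀ (m : ℕ) (p : Fin (m + 1) → A × A), (∀ i, p i ∈ Γ) →
    (∑ i, c (p i).1 (p i).2) ≤ ∑ i, c (p i).1 (p (i + 1)).2

/-- Two curves are antagonist if they pass through two distinct points in opposite orders. -/
def Antagonist {X : Type*} (γ β : ℝ → X) : Prop :=
  ∃ x y : X, x ≠ y ∧ (∃ s t : ℝ, s < t ∧ γ s = x ∧ γ t = y) ∧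
    (∃ s t : ℝ, s < t ∧ β s = y ∧ β t = x)

/-! ## Negative curvature, trees -/

/-- Three points lying on a common geodesic. -/
def Aligned {X : Type*} [MetricSpace X] (x y z : X) : Prop :=
  dist x y + dist y z = dist x z ∨ dist y x + dist x z = dist y z ∨
    dist x z + dist z y = dist x y

/-- `X` is negatively curved: it is not a line, and the CAT(0) comparison inequality is
strict except for aligned triangles. -/
def IsNegativelyCurved (X : Type*) [MetricSpace X] : Prop :=
  (¬ ∃ f : ℝ → X, Function.Surjective f ∧ ∀ s t : ℝ, dist (f s) (f t) = |s - t|) ∧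
  ∀ (x y z : X) (γ : ℝ → X), γ 0 = y → γ 1 = z →
    IsGeodesicOnWith dist γ (Set.Icc (0:ℝ) 1) (dist y z) → ¬ Aligned x y z →
    ∀ t ∈ Set.Ioo (0:ℝ) 1,
      dist x (γ t) ^ 2 < (1 - t) * dist x y ^ 2 + t * dist x z ^ 2 - t * (1 - t) * dist y z ^ 2

/-- A metric tree (real tree): a geodesic space satisfying the four-point 0-hyperbolicity
condition. -/
def IsRealTree (X : Type*) [MetricSpace X] : Prop :=
  IsGeodesicSpace X ∧ ∀ x y z w : X,
    dist x y + dist z w ≤ max (dist x z + dist y w) (dist x w + dist y z)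

/-! ## Ends of complete geodesics -/

/-- The forward ray of a complete geodesic. -/
def lineForward {X : Type*} [MetricSpace X] (γ : GeoLine X) : RaySpace X :=
  ⟨fun t : ℝ≥0 => γ.1 (t : ℝ), by
    obtain ⟨v, hv0, hv⟩ := γ.2
    exact ⟨v, hv0, fun s t => by rw [hv, NNReal.dist_eq]⟩⟩

/-- The backward ray of a complete geodesic. -/
def lineBackward {X : Type*} [MetricSpace X] (γ : GeoLine X) : RaySpace X :=
  ⟨fun t : ℝ≥0 => γ.1 (-(t : ℝ)), by
    obtain ⟨v, hv0, hv⟩ := γ.2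
    refine ⟨v, hv0, fun s t => ?_⟩
    rw [hv, NNReal.dist_eq]
    congr 1
    rw [abs_sub_comm]
    congr 1
    ring⟩

/-- The end at `+∞` of a complete geodesic, in the cone over the boundary. -/
def lineEndPlus {X : Type*} [MetricSpace X] (γ : GeoLine X) : Cone (Boundary X) :=
  rayEnd (lineForward γ)

/-- The end at `-∞` of a complete geodesic, in the cone over the boundary. -/
def lineEndMinus {X : Type*} [MetricSpace X] (γ : GeoLine X) : Cone (Boundary X) :=
  rayEnd (lineBackward γ)

/-- `g` is a unit complete geodesic with ends `ξ` (at `-∞`) and `ζ` (at `+∞`). -/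
def LineConnects {X : Type*} [MetricSpace X] (g : ℝ → X) (ξ ζ : Boundary X) : Prop :=
  (∀ s t : ℝ, dist (g s) (g t) = |s - t|) ∧
  (∃ γ : UnitRay X, Quotient.mk (unitRaySetoid X) γ = ξ ∧
    AsymptoticMaps dist (fun u : ℝ≥0 => g (-(u : ℝ))) γ.1) ∧
  (∃ γ : UnitRay X, Quotient.mk (unitRaySetoid X) γ = ζ ∧
    AsymptoticMaps dist (fun u : ℝ≥0 => g (u : ℝ)) γ.1)

/-- Two boundary points are antipodal if they are joined by a complete geodesic. -/
def Antipodal {X : Type*} [MetricSpace X] (ξ ζ : Boundary X) : Prop :=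
  ∃ g : ℝ → X, LineConnects g ξ ζ

/-- Two measures on the boundary are antipodal if they are concentrated on antipodal sets. -/
def AntipodalMeasures {X : Type*} [MetricSpace X] (νm νp : Measure (Boundary X)) : Prop :=
  ∃ A B : Set (Boundary X), MeasurableSet A ∧ MeasurableSet B ∧ νm A = 1 ∧ νp B = 1 ∧
    ∀ ξ ∈ A, ∀ ζ ∈ B, Antipodal ξ ζ

/-- Two measures on the boundary are uniformly antipodal if their supports are antipodal. -/
def UniformlyAntipodal {X : Type*} [MetricSpace X] (νm νp : Measure (Boundary X)) : Prop :=
  ∀ ξ ∈ msupport νm, ∀ ζ ∈ msupport νp, Antipodal ξ ζ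

/-- The distance from the base point `x₀` to the geodesic line joining two boundary points
(for trees, the Gromov product). -/
def D0 {X : Type*} [MetricSpace X] (x₀ : X) (ξ ζ : Boundary X) : ℝ :=
  sInf {r : ℝ | ∃ g : ℝ → X, LineConnects g ξ ζ ∧ ∃ t : ℝ, r = dist x₀ (g t)}

/-- The unit geodesic from `ξ` to `ζ`, parametrized so that its time-`0` point is closest to
the base point `x₀`. -/
def lineFrom {X : Type*} [MetricSpace X] (x₀ : X) (ξ ζ : Boundary X) : ℝ → X :=
  haveI : Nonempty X := ⟨x₀⟩
  Classical.epsilon fun g : ℝ → X =>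
    LineConnects g ξ ζ ∧ dist x₀ (g 0) = D0 x₀ ξ ζ

/-! ## Flows on trees -/

/-- The set of boundary points whose rays eventually lie in `C`. -/
def compBdry {X : Type*} [MetricSpace X] (C : Set X) : Set (Boundary X) :=
  {ξ | ∀ γ : UnitRay X, Quotient.mk (unitRaySetoid X) γ = ξ →
    ∃ T : ℝ≥0, ∀ t : ℝ≥0, T ≤ t → γ.1 t ∈ C}

/-- The connected components of the complement of a point. -/
def treeComps {X : Type*} [TopologicalSpace X] (x : X) : Set (Set X) :=
  {C | ∃ y : X, y ≠ x ∧ C = connectedComponentIn {x}ᶜ y}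

/-- A vertex (branch point) of a tree: the complement has at least three components. -/
def IsTreeVertex {X : Type*} [TopologicalSpace X] (x : X) : Prop :=
  ∃ C₁ C₂ C₃ : Set X, C₁ ∈ treeComps x ∧ C₂ ∈ treeComps x ∧ C₃ ∈ treeComps x ∧
    C₁ ≠ C₂ ∧ C₂ ≠ C₃ ∧ C₁ ≠ C₃

/-- The value of the signed measure `ν₊ - ν₋` on a set of boundary points. -/
def sflow {X : Type*} [MetricSpace X] (νm νp : Measure (Boundary X))
    (S : Set (Boundary X)) : ℝ :=
  (νp S).toReal - (νm S).toReal

/-- The boundary directions at `x` carrying positive flow. -/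
def posBdrySet {X : Type*} [MetricSpace X] (νm νp : Measure (Boundary X)) (x : X) :
    Set (Boundary X) :=
  ⋃ (C : Set X) (_ : C ∈ treeComps x) (_ : 0 < sflow νm νp (compBdry C)), compBdry C

/-- The boundary directions at `x` carrying negative flow. -/
def negBdrySet {X : Type*} [MetricSpace X] (νm νp : Measure (Boundary X)) (x : X) :
    Set (Boundary X) :=
  ⋃ (C : Set X) (_ : C ∈ treeComps x) (_ : sflow νm νp (compBdry C) < 0), compBdry C

/-- The flow through the point `x`. -/
def flowAt {X : Type*} [MetricSpace X] (νm νp : Measure (Boundary X)) (x : X) : ℝ :=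
  sflow νm νp (posBdrySet νm νp x)

open Classical in
/-- The specific flow through `x`: the flow through `x`, not counting the edge pointing
towards the base point `x₀` when the latter is positive (resp. negative). -/
def specificFlow {X : Type*} [MetricSpace X] (νm νp : Measure (Boundary X))
    (x₀ x : X) : ℝ :=
  if x = x₀ then flowAt νm νp x
  else if 0 < sflow νm νp (compBdry (connectedComponentIn {x}ᶜ x₀)) then
    sflow νm νp (posBdrySet νm νp x \ compBdry (connectedComponentIn {x}ᶜ x₀))
  else if sflow νm νp (compBdry (connectedComponentIn {x}ᶜ x₀)) < 0 then
    - sflow νm νp (negBdrySet νm νp x \ compBdry (connectedComponentIn {x}ᶜ x₀))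
  else flowAt νm νp x

/-- The pair `(ν₋, ν₊)` is realized as the pair of ends of a complete unit-speed geodesic of
the Wasserstein space, through a displacement interpolation `m`. -/
def RealizableEnds {X : Type*} [MetricSpace X] [MeasurableSpace X]
    (νm νp : Measure (Boundary X)) : Prop :=
  ∃ (μt : ℝ → W2Space X) (m : Measure (GeoLine X)), IsProbabilityMeasure m ∧
    (∀ s t : ℝ, Wdist (μt s) (μt t) = |s - t|) ∧
    (∀ t : ℝ, m.map (fun γ : GeoLine X => γ.1 t) = (μt t).1) ∧
    m.map lineEndMinus = νm.map (fun ξ : Boundary X => coneMk ξ 1) ∧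
    m.map lineEndPlus = νp.map (fun ξ : Boundary X => coneMk ξ 1)

/-- The cost `∫ D₀² dπ` of a transport plan (the optimal transport problem for the cost
`-D₀²` is finite iff the supremum of this quantity over all couplings is finite, and its
minimizers are the maximizers of this quantity). -/
def D0cost {X : Type*} [MetricSpace X] (x₀ : X)
    (π : Measure (Boundary X × Boundary X)) : ℝ≥0∞ :=
  ∫⁻ p, ENNReal.ofReal (D0 x₀ p.1 p.2) ^ 2 ∂π

/-- The supremum of `∫ D₀² dπ` over couplings of `(ν₋, ν₊)`. -/
def D0supCost {X : Type*} [MetricSpace X] (x₀ : X) (νm νp : Measure (Boundary X)) : ℝ≥0∞ :=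
  ⨆ (π : Measure (Boundary X × Boundary X)) (_ : IsCoupling π νm νp), D0cost x₀ π

/-! ## The geodesic boundary of the Wasserstein space -/

/-- The metric topology of the Wasserstein distance. -/
instance (Y : Type*) [MetricSpace Y] [MeasurableSpace Y] : TopologicalSpace (W2Space Y) :=
  TopologicalSpace.generateFrom
    {S | ∃ (μ : W2Space Y) (ε : ℝ), S = {ν : W2Space Y | Wdist μ ν < ε}}

/-- Unit-speed geodesic rays of the Wasserstein space. -/
abbrev W2UnitRay (X : Type*) [MetricSpace X] [MeasurableSpace X] : Type _ :=
  {f : ℝ≥0 → W2Space X // ∀ s t : ℝ≥0, Wdist (f s) (f t) = dist s t}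

/-- Probability measures on the cone over the boundary with `∫ v² dν = 1`, with the weak
topology. -/
abbrev P1Cone (X : Type*) [MetricSpace X] : Type _ :=
  {ν : ProbabilityMeasure (Cone (Boundary X)) //
    ∫⁻ c, (coneSpeed c : ℝ≥0∞) ^ 2 ∂(ν : Measure (Cone (Boundary X))) = 1}

/-- Probability measures (as plain measures) on the cone over the boundary with
`∫ v² dν = 1`. -/
abbrev P1ConeM (X : Type*) [MetricSpace X] : Type _ :=
  {ν : Measure (Cone (Boundary X)) // IsProbabilityMeasure ν ∧
    ∫⁻ c, (coneSpeed c : ℝ≥0∞) ^ 2 ∂ν = 1}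


/-! ## Locally Riemannian points -/

/-- The Riemannian length of a path `γ : [0,1] → ℝⁿ` for the metric tensor `g`. -/
def riemannianPathLength {n : ℕ}
    (g : EuclideanSpace ℝ (Fin n) → EuclideanSpace ℝ (Fin n) →L[ℝ] EuclideanSpace ℝ (Fin n))
    (γ : ℝ → EuclideanSpace ℝ (Fin n)) : ℝ :=
  ∫ t in (0:ℝ)..1, Real.sqrt (@inner ℝ _ _ (g (γ t) (deriv γ t)) (deriv γ t))

/-- The Riemannian distance in `U ⊆ ℝⁿ` for the metric tensor `g`: the infimum of
Riemannian lengths of `C¹` paths in `U` joining the two points. -/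
def riemannianDist {n : ℕ} (U : Set (EuclideanSpace ℝ (Fin n)))
    (g : EuclideanSpace ℝ (Fin n) → EuclideanSpace ℝ (Fin n) →L[ℝ] EuclideanSpace ℝ (Fin n))
    (p q : EuclideanSpace ℝ (Fin n)) : ℝ :=
  sInf {L : ℝ | ∃ γ : ℝ → EuclideanSpace ℝ (Fin n), ContDiffOn ℝ 1 γ (Set.Icc (0:ℝ) 1) ∧
    (∀ t ∈ Set.Icc (0:ℝ) 1, γ t ∈ U) ∧ γ 0 = p ∧ γ 1 = q ∧ L = riemannianPathLength g γ}

/-- `x` admits a neighborhood isometric to an open subset of a Riemannian manifold of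
dimension at least 2 (expressed in a chart: an open subset of `ℝⁿ`, `n ≥ 2`, equipped with
the distance induced by a smooth positive-definite symmetric metric tensor). -/
def IsLocallyRiemannian (X : Type*) [MetricSpace X] (x : X) : Prop :=
  ∃ n : ℕ, 2 ≤ n ∧
  ∃ (U : Set (EuclideanSpace ℝ (Fin n)))
    (g : EuclideanSpace ℝ (Fin n) → EuclideanSpace ℝ (Fin n) →L[ℝ] EuclideanSpace ℝ (Fin n))
    (V : Set X) (φ : X → EuclideanSpace ℝ (Fin n)),
    IsOpen U ∧ ContDiffOn ℝ (⊤ : ℕ∞) g U ∧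
    (∀ p ∈ U, ∀ v w : EuclideanSpace ℝ (Fin n),
      @inner ℝ _ _ (g p v) w = @inner ℝ _ _ v (g p w)) ∧
    (∀ p ∈ U, ∀ v : EuclideanSpace ℝ (Fin n), v ≠ 0 → 0 < @inner ℝ _ _ (g p v) v) ∧
    V ∈ nhds x ∧ Set.BijOn φ V U ∧
    ∀ a ∈ V, ∀ b ∈ V, dist a b = riemannianDist U g (φ a) (φ b)

/-! ## The combinatorial perpendicular Radon transform on a tree -/

/-- `y` and `z` lie in the same connected component of the graph `G` minus the vertex `x`. -/
def sameComp {V : Type*} (G : SimpleGraph V) (x y z : V) : Prop :=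
  ∃ (hy : y ≠ x) (hz : z ≠ x), (G.induce {w : V | w ≠ x}).Reachable ⟨y, hy⟩ ⟨z, hz⟩

/-- The perpendicular `⊥ˣ(ef)` of a flag: the union of `{x}` and of the components of
`G - x` containing none of the vertices of `p` (for a flag, `p = {e, f}` is a pair of
neighbors of `x`). -/
def perpSet {V : Type*} (G : SimpleGraph V) (x : V) (p : Finset V) : Set V :=
  {x} ∪ {y | ∀ e ∈ p, ¬ sameComp G x y e}

/-- The combinatorial perpendicular Radon transform of a summable function `h` on the
vertices, evaluated on a flag `(x, p)`. -/
def perpRadon {V : Type*} (G : SimpleGraph V) (h : V → ℝ) (x : V) (p : Finset V) : ℝ :=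
  ∑' y : perpSet G x p, h y


/-! ### Convexity of the distance in Hadamard spaces -/

theorem IsHadamard.dist_le_of_common_start {X : Type*} [MetricSpace X] (hX : IsHadamard X)
    {γ β : ℝ → X} (h0 : γ 0 = β 0)
    (hγ : IsGeodesicOnWith dist γ (Icc 0 1) (dist (γ 0) (γ 1)))
    (hβ : IsGeodesicOnWith dist β (Icc 0 1) (dist (β 0) (β 1)))
    {l : ℝ} (hl : l ∈ Icc (0 : ℝ) 1) :
    dist (γ l) (β l) ≤ l * dist (γ 1) (β 1) := by
  have h1 := hX.cat0 (γ l) (β 0) (β 1) β rfl rfl hβ l hl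
  have h2 := hX.cat0 (β 1) (γ 0) (γ 1) γ rfl rfl hγ l hl
  have h3 : dist (γ l) (β 0) = l * dist (γ 0) (γ 1) := by
    rw [← h0, dist_comm, hγ 0 (by simp) l hl, zero_sub, abs_neg, abs_of_nonneg hl.1]
    ring
  rw [dist_comm (β 1) (γ l), dist_comm (β 1) (γ 1), dist_comm (β 1) (γ 0), h0] at h2
  rw [h3, h0] at h1
  refine abs_le_of_sq_le_sq' ?_ (mul_nonneg hl.1 dist_nonneg) |>.2
  have h4 := mul_le_mul_of_nonneg_left h2 hl.1
  nlinarith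

theorem IsGeodesicOnWith.reverse {X : Type*} [MetricSpace X] {γ : ℝ → X} {v : ℝ}
    (hγ : IsGeodesicOnWith dist γ (Icc 0 1) v) :
    IsGeodesicOnWith dist (fun l => γ (1 - l)) (Icc 0 1) v := by
  intro s hs t ht
  rw [hγ (1 - s) ⟨by linarith [hs.2], by linarith [hs.1]⟩ (1 - t)
    ⟨by linarith [ht.2], by linarith [ht.1]⟩, show 1 - s - (1 - t) = t - s by ring, abs_sub_comm]

theorem IsHadamard.dist_le_of_common_end {X : Type*} [MetricSpace X] (hX : IsHadamard X)
    {γ β : ℝ → X} (h1 : γ 1 = β 1)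
    (hγ : IsGeodesicOnWith dist γ (Icc 0 1) (dist (γ 0) (γ 1)))
    (hβ : IsGeodesicOnWith dist β (Icc 0 1) (dist (β 0) (β 1)))
    {l : ℝ} (hl : l ∈ Icc (0 : ℝ) 1) :
    dist (γ l) (β l) ≤ (1 - l) * dist (γ 0) (β 0) := by
  have := hX.dist_le_of_common_start (γ := fun l => γ (1 - l)) (β := fun l => β (1 - l))
    (by simpa using h1) (by simpa [dist_comm] using hγ.reverse)
    (by simpa [dist_comm] using hβ.reverse) (l := 1 - l)
    ⟨by linarith [hl.2], by linarith [hl.1]⟩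
  simpa using this

/-- The point at parameter `l ∈ [0, 1]` of the geodesic from `x` to `y`. -/
def geoPt {X : Type*} [MetricSpace X] (hX : IsHadamard X) (x y : X) : ℝ → X :=
  Classical.choose (hX.geodesic x y)

section geoPt

variable {X : Type*} [MetricSpace X] (hX : IsHadamard X)

theorem geoPt_zero (x y : X) : geoPt hX x y 0 = x :=
  (Classical.choose_spec (hX.geodesic x y)).1

theorem geoPt_one (x y : X) : geoPt hX x y 1 = y :=
  (Classical.choose_spec (hX.geodesic x y)).2.1

theorem isGeodesicOnWith_geoPt (x y : X) :
    IsGeodesicOnWith dist (geoPt hX x y) (Icc 0 1) (dist x y) :=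
  (Classical.choose_spec (hX.geodesic x y)).2.2

theorem isGeodesicOnWith_geoPt' (x y : X) :
    IsGeodesicOnWith dist (geoPt hX x y) (Icc 0 1)
      (dist (geoPt hX x y 0) (geoPt hX x y 1)) := by
  simpa only [geoPt_zero, geoPt_one] using isGeodesicOnWith_geoPt hX x y

end geoPt

/-- Busemann convexity of a Hadamard space. -/
theorem IsHadamard.dist_le_convex {X : Type*} [MetricSpace X] (hX : IsHadamard X)
    {γ β : ℝ → X}
    (hγ : IsGeodesicOnWith dist γ (Icc 0 1) (dist (γ 0) (γ 1)))
    (hβ : IsGeodesicOnWith dist β (Icc 0 1) (dist (β 0) (β 1)))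
    {l : ℝ} (hl : l ∈ Icc (0 : ℝ) 1) :
    dist (γ l) (β l) ≤ (1 - l) * dist (γ 0) (β 0) + l * dist (γ 1) (β 1) := by
  have hg := isGeodesicOnWith_geoPt' hX (γ 0) (β 1)
  have h1 := hX.dist_le_of_common_start (geoPt_zero hX (γ 0) (β 1)).symm hγ hg hl
  have h2 := hX.dist_le_of_common_end (geoPt_one hX (γ 0) (β 1)) hg hβ hl
  rw [geoPt_one] at h1
  rw [geoPt_zero] at h2
  linarith [dist_triangle (γ l) (geoPt hX (γ 0) (β 1) l) (β l)]

/-! ### Geodesic rays -/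

theorem dist_ray {X : Type*} [MetricSpace X] (γ : RaySpace X) (s t : ℝ≥0) :
    dist (γ.1 s) (γ.1 t) = raySpeed γ * |(s : ℝ) - t| := by
  obtain ⟨v, hv0, hv⟩ := γ.2
  rw [raySpeed_eq γ hv0 hv, hv, NNReal.dist_eq]

theorem isGeodesicOnWith_ray {X : Type*} [MetricSpace X] (γ : RaySpace X) (T : ℝ≥0) :
    IsGeodesicOnWith dist (fun l : ℝ => γ.1 (l.toNNReal * T)) (Icc 0 1)
      (dist (γ.1 ((0 : ℝ).toNNReal * T)) (γ.1 ((1 : ℝ).toNNReal * T))) := by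
  intro s hs t ht
  simp only [dist_ray, NNReal.coe_mul, Real.coe_toNNReal _ hs.1, Real.coe_toNNReal _ ht.1]
  rw [← sub_mul, abs_mul]
  simp
  ring

/-! ### The ray issued from a base point and asymptotic to a given ray -/

section straighten

variable {X : Type*} [MetricSpace X] (hX : IsHadamard X) (x₀ : X)

theorem dist_geoPt_ray_le (γ : RaySpace X) {s n : ℝ≥0} (hn : 0 < n) (hs : s ≤ n) :
    dist (geoPt hX x₀ (γ.1 n) (s / n)) (γ.1 s) ≤ dist x₀ (γ.1 0) := by
  have hl : (s : ℝ) / n ∈ Icc (0 : ℝ) 1 :=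
    ⟨by positivity, div_le_one_of_le₀ (by exact_mod_cast hs) n.2⟩
  have h := hX.dist_le_convex (isGeodesicOnWith_geoPt' hX x₀ (γ.1 n))
    (isGeodesicOnWith_ray γ n) hl
  have e : ((s : ℝ) / n).toNNReal * n = s := by
    rw [← NNReal.coe_div, Real.toNNReal_coe, div_mul_cancel₀ _ hn.ne']
  simp only [geoPt_zero, geoPt_one, Real.toNNReal_zero, Real.toNNReal_one, one_mul, zero_mul,
    dist_self, mul_zero, add_zero, e] at h
  nlinarith [hl.1, dist_nonneg (x := x₀) (y := γ.1 0)]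

theorem dist_geoPt_geoPt_le (γ : RaySpace X) {s n m : ℝ≥0} (hn : 0 < n) (hs : s ≤ n)
    (hm : n ≤ m) :
    dist (geoPt hX x₀ (γ.1 n) (s / n)) (geoPt hX x₀ (γ.1 m) (s / m)) ≤
      s / n * dist x₀ (γ.1 0) := by
  have hl : (s : ℝ) / n ∈ Icc (0 : ℝ) 1 :=
    ⟨by positivity, div_le_one_of_le₀ (by exact_mod_cast hs) n.2⟩
  have hn' : (0 : ℝ) < n := hn
  have hm' : (0 : ℝ) < m := hn.trans_le hm
  have hk : (n : ℝ) / m ∈ Icc (0 : ℝ) 1 :=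
    ⟨by positivity, div_le_one_of_le₀ (by exact_mod_cast hm) m.2⟩
  have hg := isGeodesicOnWith_geoPt hX x₀ (γ.1 m)
  have hsub : ∀ l ∈ Icc (0 : ℝ) 1, l * (n / m : ℝ) ∈ Icc (0 : ℝ) 1 := fun l hl =>
    ⟨mul_nonneg hl.1 hk.1, mul_le_one₀ hl.2 hk.1 hk.2⟩
  have h := hX.dist_le_of_common_start (γ := geoPt hX x₀ (γ.1 n))
    (β := fun l => geoPt hX x₀ (γ.1 m) (l * (n / m : ℝ))) (by simp [geoPt_zero])
    (isGeodesicOnWith_geoPt' hX x₀ (γ.1 n)) (by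
      intro a ha b hb
      rw [hg _ (hsub a ha) _ (hsub b hb), hg _ (hsub 0 (by simp)) _ (hsub 1 (by simp)),
        ← sub_mul, ← sub_mul, abs_mul, abs_mul]
      simp
      ring) hl
  rw [geoPt_one, one_mul, show (s : ℝ) / n * (n / m) = s / m by field_simp, dist_comm (γ.1 n)] at h
  exact h.trans (mul_le_mul_of_nonneg_left
    (dist_geoPt_ray_le hX x₀ γ (hn.trans_le hm) hm) hl.1)

theorem exists_straighten (γ : RaySpace X) :
    ∃ β : RaySpace X, raySpeed β = raySpeed γ ∧ ∀ s n : ℝ≥0, 0 < n → s ≤ n →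
      dist (geoPt hX x₀ (γ.1 n) (s / n)) (β.1 s) ≤ s / n * dist x₀ (γ.1 0) := by
  have := hX.complete
  set C := dist x₀ (γ.1 0)
  set z : ℝ≥0 → ℕ → X := fun s n => geoPt hX x₀ (γ.1 n) (s / (n : ℝ≥0))
  have hdiv : ∀ c : ℝ, Tendsto (fun n : ℕ => c / n) atTop (𝓝 0) := fun c =>
    tendsto_const_div_atTop_nhds_zero_nat c
  have hlarge : ∀ s : ℝ≥0, ∀ᶠ n : ℕ in atTop, s ≤ n := fun s =>
    tendsto_natCast_atTop_atTop.eventually_ge_atTop s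
  have hc : ∀ s, CauchySeq (z s) := by
    intro s
    obtain ⟨N, hN⟩ := eventually_atTop.1 ((hlarge s).and (eventually_gt_atTop 0))
    rw [Metric.cauchySeq_iff']
    intro ε hε
    obtain ⟨M, hM⟩ := eventually_atTop.1 ((hdiv (s * C)).eventually_lt_const hε)
    refine ⟨max N M, fun n hn => ?_⟩
    have h1 := hN (max N M) (le_max_left _ _)
    have h2 := hM (max N M) (le_max_right _ _)
    rw [dist_comm]
    refine (dist_geoPt_geoPt_le hX x₀ γ (by exact_mod_cast h1.2) h1.1
      (by exact_mod_cast hn)).trans_lt ?_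
    rw [div_mul_eq_mul_div]
    simpa using h2
  choose f hf using fun s => cauchySeq_tendsto_of_complete (hc s)
  have happrox : ∀ s n : ℝ≥0, 0 < n → s ≤ n →
      dist (geoPt hX x₀ (γ.1 n) (s / n)) (f s) ≤ s / n * C := by
    intro s n hn hs
    refine le_of_tendsto (tendsto_const_nhds.dist (hf s)) ?_
    filter_upwards [hlarge n] with m hm
    exact dist_geoPt_geoPt_le hX x₀ γ hn hs hm
  have hspeed : Tendsto (fun n : ℕ => dist x₀ (γ.1 n) / n) atTop (𝓝 (raySpeed γ)) := by
    have h1 : Tendsto (fun n : ℕ => (raySpeed γ : ℝ) - C / n) atTop (𝓝 (raySpeed γ)) := by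
      simpa using (tendsto_const_nhds (x := (raySpeed γ : ℝ))).sub (hdiv C)
    have h2 : Tendsto (fun n : ℕ => (raySpeed γ : ℝ) + C / n) atTop (𝓝 (raySpeed γ)) := by
      simpa using (tendsto_const_nhds (x := (raySpeed γ : ℝ))).add (hdiv C)
    refine tendsto_of_tendsto_of_tendsto_of_le_of_le' h1 h2 ?_ ?_
    all_goals
      filter_upwards [eventually_gt_atTop 0] with n hn
      have hn' : (0 : ℝ) < n := by exact_mod_cast hn
      have hd : dist (γ.1 0) (γ.1 n) = raySpeed γ * n := by rw [dist_ray]; simp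
    · rw [le_div_iff₀ hn', sub_mul, div_mul_cancel₀ _ hn'.ne']
      linarith [dist_triangle_left (γ.1 0) (γ.1 n) x₀]
    · rw [div_le_iff₀ hn', add_mul, div_mul_cancel₀ _ hn'.ne']
      linarith [dist_triangle x₀ (γ.1 0) (γ.1 n)]
  have hray : ∀ s t : ℝ≥0, dist (f s) (f t) = raySpeed γ * dist s t := by
    intro s t
    refine tendsto_nhds_unique ((hf s).dist (hf t)) ?_
    refine (hspeed.mul_const (dist s t)).congr' ?_
    filter_upwards [hlarge s, hlarge t, eventually_gt_atTop 0] with n hs ht hn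
    have hn' : (0 : ℝ) < n := by exact_mod_cast hn
    have hmem : ∀ s : ℝ≥0, s ≤ n → (s : ℝ) / (n : ℝ≥0) ∈ Icc (0 : ℝ) 1 := fun s hs =>
      ⟨by positivity, div_le_one_of_le₀ (by exact_mod_cast hs) (by positivity)⟩
    rw [isGeodesicOnWith_geoPt hX x₀ (γ.1 n) _ (hmem s hs) _ (hmem t ht), ← sub_div, abs_div,
      NNReal.dist_eq]
    simp only [NNReal.coe_natCast, abs_of_pos hn']
    ring
  refine ⟨⟨f, raySpeed γ, (raySpeed γ).2, hray⟩, ?_, happrox⟩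
  exact NNReal.coe_injective (raySpeed_eq _ (raySpeed γ).2 hray)

/-- The ray issued from `x₀` asymptotic to `γ` (with the same speed). -/
def straighten (γ : RaySpace X) : RaySpace X :=
  Classical.choose (exists_straighten hX x₀ γ)

theorem raySpeed_straighten (γ : RaySpace X) :
    raySpeed (straighten hX x₀ γ) = raySpeed γ :=
  (Classical.choose_spec (exists_straighten hX x₀ γ)).1

theorem dist_geoPt_straighten_le (γ : RaySpace X) {s n : ℝ≥0} (hn : 0 < n) (hs : s ≤ n) :
    dist (geoPt hX x₀ (γ.1 n) (s / n)) ((straighten hX x₀ γ).1 s) ≤ s / n * dist x₀ (γ.1 0) :=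
  (Classical.choose_spec (exists_straighten hX x₀ γ)).2 s n hn hs

theorem straighten_zero (γ : RaySpace X) : (straighten hX x₀ γ).1 0 = x₀ := by
  have h := dist_geoPt_straighten_le hX x₀ γ one_pos (zero_le_one' ℝ≥0)
  simp only [NNReal.coe_zero, zero_div, zero_mul, geoPt_zero] at h
  exact (dist_le_zero.1 h).symm

theorem dist_straighten_le (γ β : RaySpace X) {s t : ℝ≥0} (ht : 0 < t) (hst : s ≤ t) :
    dist ((straighten hX x₀ γ).1 s) ((straighten hX x₀ β).1 s) ≤
      s / t * (dist (γ.1 t) (β.1 t) + dist x₀ (γ.1 0) + dist x₀ (β.1 0)) := by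
  have h1 := dist_geoPt_straighten_le hX x₀ γ ht hst
  have h2 := dist_geoPt_straighten_le hX x₀ β ht hst
  have h3 := hX.dist_le_of_common_start (γ := geoPt hX x₀ (γ.1 t)) (β := geoPt hX x₀ (β.1 t))
    (by simp [geoPt_zero]) (isGeodesicOnWith_geoPt' hX _ _) (isGeodesicOnWith_geoPt' hX _ _)
    (l := (s : ℝ) / t) ⟨by positivity, div_le_one_of_le₀ (by exact_mod_cast hst) t.2⟩
  simp only [geoPt_one] at h3
  rw [dist_comm] at h1
  linarith [dist_triangle4 ((straighten hX x₀ γ).1 s) (geoPt hX x₀ (γ.1 t) (s / t))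
    (geoPt hX x₀ (β.1 t) (s / t)) ((straighten hX x₀ β).1 s)]

theorem dist_straighten_self_le (γ : RaySpace X) (s : ℝ≥0) :
    dist ((straighten hX x₀ γ).1 s) (γ.1 s) ≤ dist x₀ (γ.1 0) := by
  have hlim : Tendsto (fun n : ℕ => s / (n : ℝ) * dist x₀ (γ.1 0) + dist x₀ (γ.1 0)) atTop
      (𝓝 (0 * dist x₀ (γ.1 0) + dist x₀ (γ.1 0))) :=
    ((tendsto_const_div_atTop_nhds_zero_nat (s : ℝ)).mul_const _).add_const _
  rw [zero_mul, zero_add] at hlim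
  refine ge_of_tendsto hlim ?_
  filter_upwards [tendsto_natCast_atTop_atTop.eventually_ge_atTop s, eventually_gt_atTop 0]
    with n hs hn
  have hn' : (0 : ℝ≥0) < n := by exact_mod_cast hn
  have h1 := dist_geoPt_straighten_le hX x₀ γ hn' hs
  have h2 := dist_geoPt_ray_le hX x₀ γ hn' hs
  rw [NNReal.coe_natCast] at h1 h2
  linarith [dist_triangle_left ((straighten hX x₀ γ).1 s) (γ.1 s)
    (geoPt hX x₀ (γ.1 n) (s / n))]

theorem straighten_eq_of_tendsto (γ β : RaySpace X)
    (h : Tendsto (fun t : ℝ≥0 => dist (γ.1 t) (β.1 t) / (t : ℝ)) atTop (𝓝 0)) :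
    straighten hX x₀ γ = straighten hX x₀ β := by
  refine Subtype.ext (funext fun s => dist_le_zero.1 ?_)
  have hinv : Tendsto (fun t : ℝ≥0 => ((t : ℝ))⁻¹) atTop (𝓝 0) :=
    tendsto_inv_atTop_zero.comp (NNReal.tendsto_coe_atTop.2 tendsto_id)
  have hlim := (h.add (hinv.const_mul (dist x₀ (γ.1 0) + dist x₀ (β.1 0)))).const_mul (s : ℝ)
  simp only [mul_zero, add_zero] at hlim
  refine ge_of_tendsto hlim ?_
  filter_upwards [eventually_ge_atTop s, eventually_gt_atTop 0] with t hs ht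
  refine (dist_straighten_le hX x₀ γ β ht hs).trans_eq ?_
  have : (0 : ℝ) < t := ht
  field_simp
  ring

theorem continuous_straighten : Continuous (straighten hX x₀) := by
  refine Continuous.subtype_mk (continuous_pi fun s => ?_) _
  rw [continuous_iff_continuousAt]
  intro γ
  rw [ContinuousAt, tendsto_iff_dist_tendsto_zero]
  have heval : ∀ t : ℝ≥0, Continuous fun β : RaySpace X => β.1 t := fun t =>
    (continuous_apply t).comp continuous_subtype_val
  rw [Metric.tendsto_nhds]
  intro ε hε
  have hlim : Tendsto (fun n : ℕ => s / (n : ℝ) * (dist x₀ (γ.1 0) + dist x₀ (γ.1 0))) atTop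
      (𝓝 0) := by
    simpa using (tendsto_const_div_atTop_nhds_zero_nat (s : ℝ)).mul_const
      (dist x₀ (γ.1 0) + dist x₀ (γ.1 0))
  obtain ⟨n, hnε, hsn, hn⟩ := ((hlim.eventually_lt_const hε).and
    ((tendsto_natCast_atTop_atTop.eventually_ge_atTop s).and (eventually_gt_atTop 0))).exists
  have hn' : (0 : ℝ≥0) < n := by exact_mod_cast hn
  have hcont : Continuous fun β : RaySpace X =>
      s / (n : ℝ) * (dist (β.1 n) (γ.1 n) + dist x₀ (β.1 0) + dist x₀ (γ.1 0)) := by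
    exact continuous_const.mul ((((heval n).dist continuous_const).add
      (continuous_const.dist (heval 0))).add continuous_const)
  have hev := hcont.continuousAt (x := γ) |>.eventually_lt_const (u := ε) (by simpa using hnε)
  filter_upwards [hev] with β hβ
  rw [Real.dist_0_eq_abs, abs_of_nonneg dist_nonneg]
  refine (dist_straighten_le hX x₀ β γ hn' hsn).trans_lt ?_
  simpa using hβ

end straighten

/-! ### The asymptotic distance of two rays -/

theorem tendsto_div_of_abs_sub_le {f g : ℝ≥0 → ℝ} {C L : ℝ} (h : ∀ t, |f t - g t| ≤ C)
    (hf : Tendsto (fun t => f t / (t : ℝ)) atTop (𝓝 L)) :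
    Tendsto (fun t => g t / (t : ℝ)) atTop (𝓝 L) := by
  have hinv : Tendsto (fun t : ℝ≥0 => ((t : ℝ))⁻¹) atTop (𝓝 0) :=
    tendsto_inv_atTop_zero.comp (NNReal.tendsto_coe_atTop.2 tendsto_id)
  have h0 : Tendsto (fun t => (f t - g t) / (t : ℝ)) atTop (𝓝 0) := by
    refine squeeze_zero_norm (a := fun t : ℝ≥0 => C * (t : ℝ)⁻¹) (fun t => ?_)
      (by simpa using hinv.const_mul C)
    rw [Real.norm_eq_abs, abs_div, NNReal.abs_eq, div_eq_mul_inv]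
    exact mul_le_mul_of_nonneg_right (h t) (by positivity)
  have := hf.sub h0
  rw [sub_zero] at this
  refine this.congr fun t => ?_
  ring

theorem abs_dist_sub_dist_le {X : Type*} [MetricSpace X] (a b c d : X) :
    |dist a b - dist c d| ≤ dist a c + dist b d := by
  rw [abs_le]
  constructor
  · linarith [dist_triangle4 c a b d, dist_comm c a]
  · linarith [dist_triangle4 a c d b, dist_comm d b]

/-- A unit speed ray, as a ray. -/
def unitToRay {X : Type*} [MetricSpace X] (u : UnitRay X) : RaySpace X :=
  ⟨u.1, 1, zero_le_one, fun s t => (u.2 s t).trans (one_mul _).symm⟩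

theorem raySpeed_unitToRay {X : Type*} [MetricSpace X] (u : UnitRay X) :
    raySpeed (unitToRay u) = 1 :=
  NNReal.coe_injective
    (raySpeed_eq _ zero_le_one fun s t => (u.2 s t).trans (one_mul _).symm)

theorem nnreal_dist_zero_left (a : ℝ≥0) : dist 0 a = a := by
  simp [NNReal.dist_eq]

theorem nnreal_dist_zero_right (a : ℝ≥0) : dist a 0 = a := by
  simp [NNReal.dist_eq]

/-- The cosine of the comparison angle, at the common origin of `u` and `w`, of the triangle with
the two other vertices `u a` and `w b`. -/
def cosComparison {X : Type*} [MetricSpace X] (u w : ℝ≥0 → X) (a b : ℝ≥0) : ℝ :=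
  ((a : ℝ) ^ 2 + (b : ℝ) ^ 2 - dist (u a) (w b) ^ 2) / (2 * a * b)

section cosComparison

variable {X : Type*} [MetricSpace X]

theorem cosComparison_comm (u w : ℝ≥0 → X) (a b : ℝ≥0) :
    cosComparison u w a b = cosComparison w u b a := by
  rw [cosComparison, cosComparison, dist_comm]
  ring

theorem dist_sq_eq_cosComparison (u w : ℝ≥0 → X) {a b : ℝ≥0} (ha : 0 < a) (hb : 0 < b) :
    dist (u a) (w b) ^ 2 = (a : ℝ) ^ 2 + (b : ℝ) ^ 2 - 2 * a * b * cosComparison u w a b := by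
  have ha' : (a : ℝ) ≠ 0 := by exact_mod_cast ha.ne'
  have hb' : (b : ℝ) ≠ 0 := by exact_mod_cast hb.ne'
  rw [cosComparison]
  field_simp
  ring

theorem neg_one_le_cosComparison {u w : UnitRay X} (h0 : u.1 0 = w.1 0) {a b : ℝ≥0}
    (ha : 0 < a) (hb : 0 < b) : -1 ≤ cosComparison u.1 w.1 a b := by
  have ha' : (0 : ℝ) < a := ha
  have hb' : (0 : ℝ) < b := hb
  have h1 : dist (u.1 a) (u.1 0) = a := by rw [u.2, nnreal_dist_zero_right]
  have h2 : dist (w.1 0) (w.1 b) = b := by rw [w.2, nnreal_dist_zero_left]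
  have h3 := dist_triangle (u.1 a) (u.1 0) (w.1 b)
  rw [h1, h0, h2] at h3
  rw [cosComparison, le_div_iff₀ (by positivity)]
  nlinarith [dist_nonneg (x := u.1 a) (y := w.1 b)]

theorem cosComparison_le_one {u w : UnitRay X} (h0 : u.1 0 = w.1 0) {a b : ℝ≥0}
    (ha : 0 < a) (hb : 0 < b) : cosComparison u.1 w.1 a b ≤ 1 := by
  have ha' : (0 : ℝ) < a := ha
  have hb' : (0 : ℝ) < b := hb
  have h1 : dist (u.1 a) (u.1 0) = a := by rw [u.2, nnreal_dist_zero_right]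
  have h2 : dist (w.1 0) (w.1 b) = b := by rw [w.2, nnreal_dist_zero_left]
  have h3 := dist_triangle (u.1 a) (w.1 b) (w.1 0)
  have h4 := dist_triangle (w.1 b) (u.1 a) (u.1 0)
  rw [dist_comm (w.1 b) (w.1 0), h2, ← h0, h1] at h3
  rw [dist_comm (w.1 b) (u.1 a), h1, h0, dist_comm (w.1 b), h2] at h4
  rw [cosComparison, div_le_iff₀ (by positivity)]
  have : |(a : ℝ) - b| ≤ dist (u.1 a) (w.1 b) := abs_le.2 ⟨by linarith, by linarith⟩
  have := pow_le_pow_left₀ (abs_nonneg _) this 2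
  rw [sq_abs] at this
  linarith

theorem IsHadamard.cosComparison_anti_left (hX : IsHadamard X) {u w : UnitRay X}
    (h0 : u.1 0 = w.1 0) {a a' b : ℝ≥0} (ha : 0 < a) (hb : 0 < b) (h : a ≤ a') :
    cosComparison u.1 w.1 a' b ≤ cosComparison u.1 w.1 a b := by
  have ha' : (0 : ℝ) < a := ha
  have hb' : (0 : ℝ) < b := hb
  have ha'' : (0 : ℝ) < a' := ha.trans_le h
  set l : ℝ := a / a'
  have hl : l ∈ Icc (0 : ℝ) 1 :=
    ⟨by positivity, div_le_one_of_le₀ (by exact_mod_cast h) a'.2⟩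
  have e : ((a : ℝ) / a').toNNReal * a' = a := by
    rw [← NNReal.coe_div, Real.toNNReal_coe, div_mul_cancel₀ _ (ha.trans_le h).ne']
  have hg := isGeodesicOnWith_ray (unitToRay u) a'
  have h1 := hX.cat0 (w.1 b) _ _ _ rfl rfl hg l hl
  simp only [unitToRay, Real.toNNReal_zero, Real.toNNReal_one, one_mul, zero_mul, l, e] at h1
  have h2 : dist (w.1 b) (u.1 0) = b := by rw [h0, w.2, nnreal_dist_zero_right]
  have h3 : dist (u.1 0) (u.1 a') = a' := by rw [u.2, nnreal_dist_zero_left]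
  rw [h2, h3, dist_comm (w.1 b), dist_comm (w.1 b)] at h1
  rw [cosComparison, cosComparison, div_le_div_iff₀ (by positivity) (by positivity)]
  field_simp at h1
  nlinarith [mul_le_mul_of_nonneg_left h1 hb'.le]

theorem IsHadamard.cosComparison_anti (hX : IsHadamard X) {u w : UnitRay X}
    (h0 : u.1 0 = w.1 0) {a a' b b' : ℝ≥0} (ha : 0 < a) (hb : 0 < b) (h : a ≤ a')
    (h' : b ≤ b') : cosComparison u.1 w.1 a' b' ≤ cosComparison u.1 w.1 a b := by
  refine (hX.cosComparison_anti_left h0 ha (hb.trans_le h') h).trans ?_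
  rw [cosComparison_comm, cosComparison_comm _ _ a b]
  exact hX.cosComparison_anti_left h0.symm hb ha h'

theorem IsHadamard.exists_tendsto_cosComparison (hX : IsHadamard X) {u w : UnitRay X}
    (h0 : u.1 0 = w.1 0) : ∃ c ≤ 1, ∀ p q : ℝ≥0, 0 < p → 0 < q →
      Tendsto (fun t : ℝ≥0 => cosComparison u.1 w.1 (p * t) (q * t)) atTop (𝓝 c) := by
  set g : ℝ≥0 → ℝ := fun t => cosComparison u.1 w.1 (max t 1) (max t 1)
  have hpos : ∀ t : ℝ≥0, 0 < max t 1 := fun t => lt_max_of_lt_right one_pos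
  have hanti : Antitone g := fun s t hst =>
    hX.cosComparison_anti h0 (hpos s) (hpos s) (max_le_max_right 1 hst) (max_le_max_right 1 hst)
  have hbdd : BddBelow (range g) :=
    ⟨-1, by rintro _ ⟨t, rfl⟩; exact neg_one_le_cosComparison h0 (hpos t) (hpos t)⟩
  have hlim := tendsto_atTop_ciInf hanti hbdd
  refine ⟨_, (ciInf_le hbdd 0).trans (cosComparison_le_one h0 (hpos 0) (hpos 0)),
    fun p q hp hq => ?_⟩
  have hmul : ∀ m : ℝ≥0, 0 < m → Tendsto (fun t : ℝ≥0 => m * t) atTop atTop := fun m hm =>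
    tendsto_id.const_mul_atTop hm
  have hev : ∀ m : ℝ≥0, 0 < m → Tendsto (fun t : ℝ≥0 => cosComparison u.1 w.1 (m * t) (m * t))
      atTop (𝓝 (⨅ i, g i)) := by
    intro m hm
    refine (hlim.comp (hmul m hm)).congr' ?_
    filter_upwards [(hmul m hm).eventually_ge_atTop 1] with t ht
    simp [g, max_eq_left ht]
  have hm : 0 < min p q := lt_min hp hq
  have hM : 0 < max p q := lt_max_of_lt_left hp
  refine tendsto_of_tendsto_of_tendsto_of_le_of_le' (hev _ hM) (hev _ hm) ?_ ?_
  · filter_upwards [eventually_gt_atTop 0] with t ht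
    refine hX.cosComparison_anti h0 (by positivity) (by positivity) ?_ ?_ <;> gcongr
    exacts [le_max_left _ _, le_max_right _ _]
  · filter_upwards [eventually_gt_atTop 0] with t ht
    refine hX.cosComparison_anti h0 (by positivity) (by positivity) ?_ ?_ <;> gcongr
    exacts [min_le_left _ _, min_le_right _ _]

theorem IsHadamard.exists_tendsto_dist_div (hX : IsHadamard X) (u w : UnitRay X) :
    ∃ c ≤ 1, ∀ p q : ℝ≥0, Tendsto (fun t : ℝ≥0 => dist (u.1 (p * t)) (w.1 (q * t)) / (t : ℝ))
      atTop (𝓝 (Real.sqrt ((p : ℝ) ^ 2 + (q : ℝ) ^ 2 - 2 * p * q * c))) := by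
  have key : ∀ u w : UnitRay X, u.1 0 = w.1 0 → ∃ c ≤ 1, ∀ p q : ℝ≥0,
      Tendsto (fun t : ℝ≥0 => dist (u.1 (p * t)) (w.1 (q * t)) / (t : ℝ))
        atTop (𝓝 (Real.sqrt ((p : ℝ) ^ 2 + (q : ℝ) ^ 2 - 2 * p * q * c))) := by
    intro u w h0
    obtain ⟨c, hc, hlim⟩ := hX.exists_tendsto_cosComparison h0
    refine ⟨c, hc, fun p q => ?_⟩
    rcases eq_or_lt_of_le (zero_le : 0 ≤ p) with rfl | hp
    · refine tendsto_const_nhds.congr' ?_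
      filter_upwards [eventually_gt_atTop 0] with t ht
      have ht' : (t : ℝ) ≠ 0 := by exact_mod_cast ht.ne'
      rw [zero_mul, h0, w.2, nnreal_dist_zero_left]
      simp [ht']
    rcases eq_or_lt_of_le (zero_le : 0 ≤ q) with rfl | hq
    · refine tendsto_const_nhds.congr' ?_
      filter_upwards [eventually_gt_atTop 0] with t ht
      have ht' : (t : ℝ) ≠ 0 := by exact_mod_cast ht.ne'
      rw [zero_mul, ← h0, u.2, nnreal_dist_zero_right]
      simp [ht']
    have h1 := (((hlim p q hp hq).const_mul (2 * p * q : ℝ)).const_sub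
      ((p : ℝ) ^ 2 + (q : ℝ) ^ 2)).sqrt
    refine h1.congr' ?_
    filter_upwards [eventually_gt_atTop 0] with t ht
    have ht' : (0 : ℝ) < t := ht
    have h2 := dist_sq_eq_cosComparison u.1 w.1 (a := p * t) (b := q * t) (by positivity)
      (by positivity)
    rw [← Real.sqrt_sq (show 0 ≤ dist (u.1 (p * t)) (w.1 (q * t)) / (t : ℝ) by positivity),
      div_pow, h2]
    congr 1
    push_cast
    field_simp
  set x₀ := u.1 0
  have hs : ∀ u : UnitRay X, ∀ s t : ℝ≥0,
      dist ((straighten hX x₀ (unitToRay u)).1 s) ((straighten hX x₀ (unitToRay u)).1 t)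
        = dist s t := fun u s t => by
    rw [dist_ray, raySpeed_straighten, raySpeed_unitToRay, NNReal.dist_eq]
    simp
  obtain ⟨c, hc, h⟩ := key ⟨(straighten hX x₀ (unitToRay u)).1, hs u⟩
    ⟨(straighten hX x₀ (unitToRay w)).1, hs w⟩
    (by simp only [straighten_zero])
  refine ⟨c, hc, fun p q => ?_⟩
  refine tendsto_div_of_abs_sub_le (C := dist x₀ (u.1 0) + dist x₀ (w.1 0)) (fun t => ?_) (h p q)
  exact (abs_dist_sub_dist_le _ _ _ _).trans (add_le_add
    (dist_straighten_self_le hX x₀ (unitToRay u) _)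
    (dist_straighten_self_le hX x₀ (unitToRay w) _))

theorem IsHadamard.tendsto_dist_div_dInfty (hX : IsHadamard X) (u w : UnitRay X) (p q : ℝ≥0) :
    Tendsto (fun t : ℝ≥0 => dist (u.1 (p * t)) (w.1 (q * t)) / (t : ℝ)) atTop
      (𝓝 (Real.sqrt (((p : ℝ) - q) ^ 2 + p * q * dInfty u.1 w.1 ^ 2))) := by
  obtain ⟨c, hc, h⟩ := hX.exists_tendsto_dist_div u w
  have h1 := h 1 1
  simp only [one_mul] at h1
  have h2 : dInfty u.1 w.1 = _ := h1.limsup_eq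
  convert h p q using 3
  rw [h2, Real.sq_sqrt (by push_cast; linarith)]
  push_cast
  ring

end cosComparison

section rayEnd

variable {X : Type*} [MetricSpace X]

theorem rayEnd_eq_of_asymptotic {γ β : RaySpace X} (hs : raySpeed γ = raySpeed β)
    (h : AsymptoticMaps dist γ.1 β.1) : rayEnd γ = rayEnd β := by
  unfold rayEnd
  by_cases h0 : raySpeed γ = 0
  · rw [dif_pos h0, dif_pos (hs ▸ h0)]
  · rw [dif_neg h0, dif_neg (hs ▸ h0)]
    obtain ⟨C, hC⟩ := h
    refine congrArg₂ coneMk (Quotient.sound (s := unitRaySetoid X) ⟨C, fun t => ?_⟩) hs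
    simp only [rayUnit, hs]
    exact hC _

theorem dist_ray_zero_left {γ : RaySpace X} (h : raySpeed γ = 0) (t : ℝ≥0) : γ.1 t = γ.1 0 := by
  rw [← dist_le_zero, dist_ray, h]
  simp

theorem tendsto_dist_div_of_const {γ β : RaySpace X} (h : raySpeed γ = 0) :
    Tendsto (fun t : ℝ≥0 => dist (γ.1 t) (β.1 t) / (t : ℝ)) atTop (𝓝 (raySpeed β)) := by
  refine tendsto_div_of_abs_sub_le (f := fun t => raySpeed β * t) (C := dist (β.1 0) (γ.1 0))
    (fun t => ?_) (tendsto_const_nhds.congr' ?_)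
  · have : (raySpeed β : ℝ) * t = dist (β.1 0) (β.1 t) := by rw [dist_ray]; simp
    rw [this, dist_ray_zero_left h]
    simpa using abs_dist_sub_dist_le (β.1 0) (β.1 t) (γ.1 0) (β.1 t)
  · filter_upwards [eventually_gt_atTop 0] with t ht
    rw [mul_div_cancel_right₀]
    exact_mod_cast ht.ne'

theorem ray_eq_rayUnit {γ : RaySpace X} (h : raySpeed γ ≠ 0) (t : ℝ≥0) :
    γ.1 t = (rayUnit γ h).1 (raySpeed γ * t) := by
  simp [rayUnit, mul_div_cancel_left₀ _ h]

theorem IsHadamard.tendsto_dist_div_coneDist (hX : IsHadamard X) (γ β : RaySpace X) :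
    Tendsto (fun t : ℝ≥0 => dist (γ.1 t) (β.1 t) / (t : ℝ)) atTop
      (𝓝 (coneDist (rayEnd γ) (rayEnd β))) := by
  by_cases hγ : raySpeed γ = 0
  · convert tendsto_dist_div_of_const hγ (β := β)
    rw [rayEnd, dif_pos hγ, rayEnd]
    split_ifs with hβ
    · rw [hβ]; rfl
    · rfl
  by_cases hβ : raySpeed β = 0
  · have h := tendsto_dist_div_of_const hβ (β := γ)
    simp only [dist_comm (β.1 _)] at h
    convert h
    rw [rayEnd, dif_neg hγ, rayEnd, dif_pos hβ]
    rfl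
  rw [rayEnd, dif_neg hγ, rayEnd, dif_neg hβ]
  set ξ : Boundary X := Quotient.mk (unitRaySetoid X) (rayUnit γ hγ)
  set ζ : Boundary X := Quotient.mk (unitRaySetoid X) (rayUnit β hβ)
  obtain ⟨C, hC⟩ : AsymptoticMaps dist ξ.out.1 (rayUnit γ hγ).1 := 
    Quotient.mk_out (s := unitRaySetoid X) (rayUnit γ hγ)
  obtain ⟨C', hC'⟩ : AsymptoticMaps dist ζ.out.1 (rayUnit β hβ).1 := 
    Quotient.mk_out (s := unitRaySetoid X) (rayUnit β hβ)
  refine tendsto_div_of_abs_sub_le (C := C + C') (fun t => ?_)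
    (hX.tendsto_dist_div_dInfty ξ.out ζ.out (raySpeed γ) (raySpeed β))
  rw [ray_eq_rayUnit hγ, ray_eq_rayUnit hβ]
  exact (abs_dist_sub_dist_le _ _ _ _).trans (add_le_add (hC _) (hC' _))

theorem coneDist_nonneg (c c' : Cone (Boundary X)) : 0 ≤ coneDist c c' := by
  induction c, c' using Quotient.inductionOn₂ with | _ a b => ?_
  rcases a with a | a <;> rcases b with b | b
  exacts [Real.sqrt_nonneg _, a.2.2, b.2.2, le_rfl]

variable (hX : IsHadamard X) (x₀ : X)

theorem rayEnd_straighten (γ : RaySpace X) : rayEnd (straighten hX x₀ γ) = rayEnd γ :=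
  rayEnd_eq_of_asymptotic (raySpeed_straighten hX x₀ γ)
    ⟨_, dist_straighten_self_le hX x₀ γ⟩

theorem straighten_eq_of_coneDist_eq_zero {γ β : RaySpace X}
    (h : coneDist (rayEnd γ) (rayEnd β) = 0) : straighten hX x₀ γ = straighten hX x₀ β :=
  straighten_eq_of_tendsto hX x₀ γ β 
    (by simpa only [h] using hX.tendsto_dist_div_coneDist γ β)

/-- The ray `t ↦ γ (s t)`. -/
def rayScale (γ : RaySpace X) (s : ℝ≥0) : RaySpace X :=
  ⟨fun t => γ.1 (s * t), raySpeed γ * s, by positivity, fun a b => by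
    rw [dist_ray, NNReal.dist_eq, NNReal.coe_mul, NNReal.coe_mul, ← mul_sub, abs_mul,
      NNReal.abs_eq]
    ring⟩

theorem raySpeed_rayScale (γ : RaySpace X) (s : ℝ≥0) :
    raySpeed (rayScale γ s) = raySpeed γ * s := by
  refine NNReal.coe_injective ?_
  change dist (γ.1 (s * 0)) (γ.1 (s * 1)) = _
  rw [dist_ray]
  simp

theorem continuous_rayEval (t : ℝ≥0) : Continuous (rayEval (X := X) t) :=
  (continuous_apply t).comp continuous_subtype_val

theorem continuous_raySpeed : Continuous (raySpeed (X := X)) :=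
  (continuous_rayEval 0).nndist (continuous_rayEval 1)

theorem continuous_rayScale : Continuous fun p : RaySpace X × ℝ≥0 => rayScale p.1 p.2 := by
  refine Continuous.subtype_mk (continuous_pi fun t => ?_) _
  rw [continuous_iff_continuousAt]
  rintro ⟨γ, s⟩
  rw [ContinuousAt, tendsto_iff_dist_tendsto_zero]
  have hcont : Continuous fun p : RaySpace X × ℝ≥0 =>
      raySpeed p.1 * |((p.2 * t : ℝ≥0) : ℝ) - (s * t : ℝ≥0)|
        + dist (rayEval (s * t) p.1) (rayEval (s * t) γ) := by
    have h1 := (continuous_raySpeed (X := X)).comp (continuous_fst (Y := ℝ≥0))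
    have h2 := (continuous_rayEval (X := X) (s * t)).comp (continuous_fst (Y := ℝ≥0))
    refine ((NNReal.continuous_coe.comp h1).mul ?_).add (h2.dist continuous_const)
    fun_prop
  have hlim := hcont.tendsto (γ, s)
  simp only [sub_self, abs_zero, mul_zero, dist_self, add_zero] at hlim
  refine squeeze_zero (fun _ => dist_nonneg) (fun p => ?_) hlim
  refine (dist_triangle _ (p.1.1 (s * t)) _).trans ?_
  rw [dist_ray]
  rfl

/-- The ray issued from `x₀` representing a point of the boundary. -/
def boundaryRay : Boundary X → RaySpace X :=
  Quotient.lift (fun u => straighten hX x₀ (unitToRay u)) (by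
    rintro u w ⟨C, hC⟩
    refine straighten_eq_of_tendsto hX x₀ _ _
      (tendsto_div_of_abs_sub_le (f := fun _ => 0) (C := C) (fun t => ?_) (by simp))
    simpa [unitToRay] using hC t)

theorem boundaryRay_zero (ξ : Boundary X) : (boundaryRay hX x₀ ξ).1 0 = x₀ := by
  induction ξ using Quotient.inductionOn with | _ u => exact straighten_zero hX x₀ _

theorem continuous_boundaryRay : Continuous (boundaryRay hX x₀) := by
  refine Continuous.quotient_lift ((continuous_straighten hX x₀).comp ?_) _
  exact Continuous.subtype_mk continuous_subtype_val _

/-- The ray issued from `x₀` representing a point of the cone over the boundary. -/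
def coneRay : Cone (Boundary X) → RaySpace X :=
  Quotient.lift (Sum.elim (fun p => rayScale (boundaryRay hX x₀ p.1) p.2)
      (fun _ => ⟨fun _ => x₀, 0, le_rfl, by simp⟩)) (by
    rintro a b (rfl | ⟨ha, hb⟩)
    · rfl
    · refine Subtype.ext (funext fun t => ?_)
      rcases a with a | a <;> rcases b with b | b <;>
        simp_all [coneIsApex, rayScale, boundaryRay_zero])

theorem continuous_coneRay : Continuous (coneRay hX x₀) := by
  refine Continuous.quotient_lift (Continuous.sumElim ?_ continuous_const) _
  exact continuous_rayScale.comp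
    (((continuous_boundaryRay hX x₀).comp continuous_fst).prodMk continuous_snd)

theorem rayEnd_coneRay (c : Cone (Boundary X)) : rayEnd (coneRay hX x₀ c) = c := by
  induction c using Quotient.inductionOn with | _ a => ?_
  rcases a with ⟨ξ, s⟩ | a
  · induction ξ using Quotient.inductionOn with | _ u => ?_
    set γ := straighten hX x₀ (unitToRay u)
    have hs : raySpeed (rayScale γ s) = s := by
      rw [raySpeed_rayScale, raySpeed_straighten, raySpeed_unitToRay, one_mul]
    change rayEnd (rayScale γ s) = _
    by_cases h0 : s = 0
    · rw [rayEnd, dif_pos (hs.trans h0)]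
      exact Quotient.sound (Or.inr ⟨trivial, h0⟩)
    · rw [rayEnd, dif_neg (by rwa [hs])]
      refine congrArg₂ coneMk (Quotient.sound (s := unitRaySetoid X)
        ⟨dist x₀ (u.1 0), fun t => ?_⟩) hs
      change dist (γ.1 (s * (t / raySpeed (rayScale γ s)))) _ ≤ _
      rw [hs, mul_div_cancel₀ _ h0]
      exact dist_straighten_self_le hX x₀ (unitToRay u) t
  · have h0 : raySpeed (coneRay hX x₀ (Quotient.mk _ (Sum.inr a))) = 0 := nndist_self x₀
    rw [rayEnd, dif_pos h0]
    rfl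

end rayEnd

/-! ### The Borel structure of the space of rays -/

section RaySpaceTopology

variable {X : Type*} [MetricSpace X]

/-- A countable dense set of times, containing `0` and `1`. -/
def rayTimes : Set ℝ≥0 := insert 0 (insert 1 (range (TopologicalSpace.denseSeq ℝ≥0)))

theorem countable_rayTimes : rayTimes.Countable :=
  ((countable_range _).insert _).insert _

theorem dense_rayTimes : Dense rayTimes :=
  (TopologicalSpace.denseRange_denseSeq ℝ≥0).mono
    ((subset_insert _ _).trans (subset_insert _ _))

instance : Countable rayTimes := countable_rayTimes.to_subtype

/-- The restriction of a ray to the times of `rayTimes`. -/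
def rayRestrict (γ : RaySpace X) : rayTimes → X := fun q => γ.1 q

theorem continuous_rayRestrict : Continuous (rayRestrict (X := X)) :=
  continuous_pi fun q => continuous_rayEval q.1

theorem injective_rayRestrict : Function.Injective (rayRestrict (X := X)) := by
  have hcont : ∀ γ : RaySpace X, Continuous γ.1 := by
    rintro ⟨γ, v, hv, h⟩
    exact (LipschitzWith.of_dist_le_mul (K := v.toNNReal) fun s t => by
      rw [h, Real.coe_toNNReal _ hv]).continuous
  intro γ β h
  refine Subtype.ext ((hcont γ).ext_on dense_rayTimes (hcont β) fun q hq => ?_)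
  exact congrFun h ⟨q, hq⟩

theorem isInducing_rayRestrict : IsInducing (rayRestrict (X := X)) := by
  refine isInducing_iff_nhds.2 fun γ => le_antisymm
    (tendsto_iff_comap.1 continuous_rayRestrict.continuousAt) ?_
  set F := comap (rayRestrict (X := X)) (𝓝 (rayRestrict γ))
  have hq : ∀ q ∈ rayTimes, Tendsto (fun δ : RaySpace X => δ.1 q) F (𝓝 (γ.1 q)) := fun q hq =>
    ((continuous_apply (⟨q, hq⟩ : rayTimes)).tendsto (rayRestrict γ)).comp tendsto_comap
  have hspeed : Tendsto (fun δ : RaySpace X => (raySpeed δ : ℝ)) F (𝓝 (raySpeed γ)) := by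
    have := (hq 0 (by simp [rayTimes])).dist (hq 1 (by simp [rayTimes]))
    simpa only [raySpeed, coe_nndist] using this
  change Tendsto id F (𝓝 γ)
  rw [tendsto_subtype_rng, tendsto_pi_nhds]
  intro t
  rw [Metric.tendsto_nhds]
  intro ε hε
  obtain ⟨q, hqm, hqt⟩ : ∃ q ∈ rayTimes, dist t q < ε / (2 * raySpeed γ + 1) :=
    dense_rayTimes.exists_dist_lt t (by positivity)
  rw [lt_div_iff₀ (by positivity)] at hqt
  have hlim : Tendsto (fun δ : RaySpace X => dist t q * raySpeed δ + dist (δ.1 q) (γ.1 q)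
      + dist t q * raySpeed γ) F (𝓝 (dist t q * raySpeed γ + 0 + dist t q * raySpeed γ)) :=
    ((hspeed.const_mul _).add (tendsto_iff_dist_tendsto_zero.1 (hq q hqm))).add_const _
  filter_upwards [hlim.eventually_lt_const (u := ε) (by nlinarith [dist_nonneg (x := t) (y := q)])]
    with δ hδ
  refine lt_of_le_of_lt ?_ hδ
  refine (dist_triangle4 (δ.1 t) (δ.1 q) (γ.1 q) (γ.1 t)).trans ?_
  rw [dist_ray, dist_ray, NNReal.dist_eq, abs_sub_comm (q : ℝ)]
  linarith

theorem isClosed_range_rayRestrict [CompleteSpace X] :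
    IsClosed (range (rayRestrict (X := X))) := by
  set z : rayTimes := ⟨0, by simp [rayTimes]⟩
  set o : rayTimes := ⟨1, by simp [rayTimes]⟩
  have hr : range (rayRestrict (X := X)) =
      {f | ∀ q r : rayTimes, dist (f q) (f r) = dist (f z) (f o) * dist q r} := by
    refine Subset.antisymm ?_ fun f hf => ?_
    · rintro _ ⟨γ, rfl⟩ q r
      exact dist_ray γ q r
    · have hunif : UniformContinuous f :=
        (LipschitzWith.of_dist_le_mul (K := nndist (f z) (f o))
          fun q r => (hf q r).le).uniformContinuous
      have hui : IsUniformInducing (Subtype.val : rayTimes → ℝ≥0) :=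
        isUniformEmbedding_subtype_val.isUniformInducing
      have hd : DenseRange (Subtype.val : rayTimes → ℝ≥0) := dense_rayTimes.denseRange_val
      set g := (hui.isDenseInducing hd).extend f
      have hg : Continuous g := (uniformContinuous_uniformly_extend hui hd hunif).continuous
      have hgf : ∀ q : rayTimes, g q = f q := fun q => uniformly_extend_of_ind hui hd hunif q
      have hdist : ∀ s t, dist (g s) (g t) = dist (f z) (f o) * dist s t := by
        refine isClosed_property2 hd (p := fun s t => dist (g s) (g t) = dist (f z) (f o) * dist s t)
          (isClosed_eq (by fun_prop) (by fun_prop)) fun q r => ?_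
        rw [hgf, hgf, hf]
        rfl
      exact ⟨⟨g, _, dist_nonneg, hdist⟩, funext hgf⟩
  rw [hr]
  simp only [ofPred_forall]
  exact isClosed_iInter fun q => isClosed_iInter fun r => isClosed_eq (by fun_prop) (by fun_prop)

theorem isClosedEmbedding_rayRestrict [CompleteSpace X] :
    IsClosedEmbedding (rayRestrict (X := X)) :=
  ⟨⟨isInducing_rayRestrict, injective_rayRestrict⟩, isClosed_range_rayRestrict⟩

instance [CompleteSpace X] [SecondCountableTopology X] : PolishSpace (RaySpace X) :=
  haveI : PolishSpace X := inferInstance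
  isClosedEmbedding_rayRestrict.polishSpace

instance [MeasurableSpace X] [BorelSpace X] [SecondCountableTopology X] :
    BorelSpace (RaySpace X) := by
  refine ⟨le_antisymm ?_ ?_⟩
  · change MeasurableSpace.comap Subtype.val MeasurableSpace.pi ≤ _
    rw [MeasurableSpace.pi, MeasurableSpace.comap_iSup]
    refine iSup_le fun t => ?_
    rw [MeasurableSpace.comap_comp, BorelSpace.measurable_eq (α := X)]
    exact (continuous_rayEval t).borel_measurable.comap_le
  · have h1 : borel (RaySpace X) = MeasurableSpace.comap rayRestrict (borel (rayTimes → X)) := by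
      rw [isInducing_rayRestrict.eq_induced, borel_comap]
    have h2 : Measurable (rayRestrict (X := X)) :=
      measurable_pi_lambda _ fun q => (measurable_pi_apply q.1).comp measurable_subtype_coe
    rw [h1, ← BorelSpace.measurable_eq (α := rayTimes → X)]
    exact h2.comap_le

theorem continuous_rayUnit :
    Continuous fun γ : {γ : RaySpace X // raySpeed γ ≠ 0} => rayUnit γ.1 γ.2 := by
  have h1 : Continuous fun γ : {γ : RaySpace X // raySpeed γ ≠ 0} =>
      rayScale γ.1 (raySpeed γ.1)⁻¹ :=
    continuous_rayScale.comp (continuous_subtype_val.prodMk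
      ((continuous_raySpeed.comp continuous_subtype_val).inv₀ fun γ => γ.2))
  refine Continuous.subtype_mk (continuous_pi fun t => ?_) _
  refine ((continuous_rayEval t).comp h1).congr fun γ => ?_
  simp only [Function.comp, rayEval, rayScale, div_eq_inv_mul]

theorem measurable_rayEnd [MeasurableSpace X] [BorelSpace X] [SecondCountableTopology X] :
    Measurable (rayEnd (X := X)) := by
  refine measurable_of_restrict_of_restrict_compl (s := {γ | raySpeed γ = 0})
    (isClosed_eq continuous_raySpeed continuous_const).measurableSet ?_ ?_
  · convert measurable_const (a := conePt (Boundary X)) using 1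
    exact funext fun γ => dif_pos γ.2
  · have h : Continuous fun γ : {γ : RaySpace X // raySpeed γ ≠ 0} =>
        coneMk (Quotient.mk (unitRaySetoid X) (rayUnit γ.1 γ.2)) (raySpeed γ.1) := by
      refine continuous_quotient_mk'.comp (continuous_inl.comp (Continuous.prodMk ?_ ?_))
      · exact continuous_quotient_mk'.comp continuous_rayUnit
      · exact continuous_raySpeed.comp continuous_subtype_val
    have e : {γ : RaySpace X | raySpeed γ = 0}ᶜ.domRestrict rayEnd = fun γ =>
        coneMk (Quotient.mk (unitRaySetoid X) (rayUnit γ.1 γ.2)) (raySpeed γ.1) :=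
      funext fun γ => dif_neg γ.2
    rw [e]
    exact h.measurable

theorem measurable_coneDist [MeasurableSpace X] [BorelSpace X] (hX : IsHadamard X) (x₀ : X) :
    Measurable fun p : Cone (Boundary X) × Cone (Boundary X) => coneDist p.1 p.2 := by
  have := hX.separable
  have := UniformSpace.secondCountable_of_separable X
  refine measurable_of_tendsto_metrizable (f := fun (n : ℕ) (p : Cone (Boundary X) ×
    Cone (Boundary X)) => dist (rayEval n (coneRay hX x₀ p.1)) (rayEval n (coneRay hX x₀ p.2)) / n)
    (fun n => ?_) (tendsto_pi_nhds.2 fun p => ?_)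
  · have h : Measurable fun c : Cone (Boundary X) => rayEval n (coneRay hX x₀ c) :=
      ((continuous_rayEval n).comp (continuous_coneRay hX x₀)).measurable
    exact ((h.comp measurable_fst).dist (h.comp measurable_snd)).div_const _
  · have h := hX.tendsto_dist_div_coneDist (coneRay hX x₀ p.1) (coneRay hX x₀ p.2)
    rw [rayEnd_coneRay, rayEnd_coneRay] at h
    refine (h.comp tendsto_natCast_atTop_atTop).congr fun n => ?_
    simp [rayEval]

theorem coneDist_self (hX : IsHadamard X) (x₀ : X) (c : Cone (Boundary X)) :
    coneDist c c = 0 := by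
  have h := hX.tendsto_dist_div_coneDist (coneRay hX x₀ c) (coneRay hX x₀ c)
  simp only [dist_self, zero_div, rayEnd_coneRay] at h
  exact tendsto_nhds_unique h tendsto_const_nhds

end RaySpaceTopology

/-! ### Couplings -/

section Couplings

open ProbabilityTheory

theorem IsCoupling.isProbabilityMeasure {A B : Type*} [MeasurableSpace A] [MeasurableSpace B]
    {π : Measure (A × B)} {μ : Measure A} {ν : Measure B} [IsProbabilityMeasure μ]
    (h : IsCoupling π μ ν) : IsProbabilityMeasure π := by
  refine ⟨?_⟩
  rw [← preimage_univ (f := Prod.fst), ← Measure.map_apply measurable_fst .univ, h.1, measure_univ]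

theorem isCoupling_prod {A B : Type*} [MeasurableSpace A] [MeasurableSpace B]
    (μ : Measure A) (ν : Measure B) [IsProbabilityMeasure μ] [IsProbabilityMeasure ν] :
    IsCoupling (μ.prod ν) μ ν := by
  constructor
  · rw [Measure.map_fst_prod, measure_univ, one_smul]
  · rw [Measure.map_snd_prod, measure_univ, one_smul]

theorem IsCoupling.map {A B A' B' : Type*} [MeasurableSpace A] [MeasurableSpace B]
    [MeasurableSpace A'] [MeasurableSpace B'] {π : Measure (A × B)} {μ : Measure A} {ν : Measure B}
    (h : IsCoupling π μ ν) {f : A → A'} {g : B → B'} (hf : Measurable f) (hg : Measurable g) :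
    IsCoupling (π.map (Prod.map f g)) (μ.map f) (ν.map g) := by
  constructor
  · rw [← h.1, Measure.map_map measurable_fst (hf.prodMap hg), Measure.map_map hf measurable_fst]
    rfl
  · rw [← h.2, Measure.map_map measurable_snd (hf.prodMap hg), Measure.map_map hg measurable_snd]
    rfl

theorem condDistrib_id_preimage_ae_eq {α A : Type*} [MeasurableSpace α] [StandardBorelSpace α]
    [Nonempty α] [MeasurableSpace A] {f : α → A} (hf : Measurable f) (μ : Measure α)
    [IsProbabilityMeasure μ] {E : Set A} (hE : MeasurableSet E) :
    (fun a => condDistrib id f μ a (f ⁻¹' E)) =ᵐ[μ.map f] E.indicator 1 := by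
  have := Measure.isProbabilityMeasure_map (μ := μ) hf.aemeasurable
  refine ae_eq_of_forall_setLIntegral_eq_of_sigmaFinite (Kernel.measurable_coe _ (hf hE))
    (measurable_one.indicator hE) fun s hs _ => ?_
  rw [setLIntegral_map hs (Kernel.measurable_coe _ (hf hE)) hf,
    setLIntegral_preimage_condDistrib hf aemeasurable_id (hf hE) hs,
    lintegral_indicator_one hE, Measure.restrict_apply hE, Measure.map_apply hf (hE.inter hs),
    inter_comm]
  rfl

theorem lintegral_condDistrib_id {α A : Type*} [MeasurableSpace α] [StandardBorelSpace α]
    [Nonempty α] [MeasurableSpace A] {f : α → A} (hf : Measurable f) (μ : Measure α)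
    [IsProbabilityMeasure μ] {U : Set α} (hU : MeasurableSet U) :
    ∫⁻ a, condDistrib id f μ a U ∂(μ.map f) = μ U := by
  rw [lintegral_map (Kernel.measurable_coe _ hU) hf]
  simpa using setLIntegral_preimage_condDistrib (μ := μ) hf aemeasurable_id hU .univ

/-- A coupling of two image measures comes from a coupling of the measures. -/
theorem exists_isCoupling_map_eq {α β A B : Type*} [MeasurableSpace α] [StandardBorelSpace α]
    [Nonempty α] [MeasurableSpace β] [StandardBorelSpace β] [Nonempty β] [MeasurableSpace A]
    [MeasurableSpace B] {f : α → A} {g : β → B} (hf : Measurable f) (hg : Measurable g)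
    {μ : Measure α} {ν : Measure β} [IsProbabilityMeasure μ] [IsProbabilityMeasure ν]
    {π : Measure (A × B)} (hπ : IsCoupling π (μ.map f) (ν.map g)) :
    ∃ P : Measure (α × β), IsCoupling P μ ν ∧ P.map (Prod.map f g) = π := by
  have := Measure.isProbabilityMeasure_map (μ := μ) hf.aemeasurable
  have := hπ.isProbabilityMeasure
  set κ := condDistrib id f μ
  set η := condDistrib id g ν
  have happ : ∀ S T, MeasurableSet S → MeasurableSet T →
      π.bind (κ ∥ₖ η) (S ×ˢ T) = ∫⁻ p, κ p.1 S * η p.2 T ∂π := fun S T hS hT => by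
    rw [Measure.bind_apply (hS.prod hT) (Kernel.aemeasurable _)]
    simp_rw [Kernel.parallelComp_apply_prod]
  refine ⟨π.bind (κ ∥ₖ η), ⟨?_, ?_⟩, ?_⟩
  · ext S hS
    rw [Measure.map_apply measurable_fst hS, ← prod_univ, happ S univ hS .univ]
    simp only [measure_univ, mul_one]
    rw [← lintegral_condDistrib_id hf μ hS, ← hπ.1,
      lintegral_map (Kernel.measurable_coe _ hS) measurable_fst]
  · ext S hS
    rw [Measure.map_apply measurable_snd hS, ← univ_prod, happ univ S .univ hS]
    simp only [measure_univ, one_mul]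
    rw [← lintegral_condDistrib_id hg ν hS, ← hπ.2,
      lintegral_map (Kernel.measurable_coe _ hS) measurable_snd]
  · have hfin : IsFiniteMeasure ((π.bind (κ ∥ₖ η)).map (Prod.map f g)) := by
      have : IsProbabilityMeasure (π.bind (κ ∥ₖ η)) := by
        refine ⟨?_⟩
        rw [← univ_prod_univ, happ univ univ .univ .univ]
        simp
      infer_instance
    refine Measure.ext_prod fun {E F} hE hF => ?_
    rw [Measure.map_apply (hf.prodMap hg) (hE.prod hF),
      show Prod.map f g ⁻¹' E ×ˢ F = (f ⁻¹' E) ×ˢ (g ⁻¹' F) from rfl, happ _ _ (hf hE) (hg hF)]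
    have h1 := condDistrib_id_preimage_ae_eq hf μ hE
    have h2 := condDistrib_id_preimage_ae_eq hg ν hF
    rw [← hπ.1] at h1
    rw [← hπ.2] at h2
    have h1' := ae_of_ae_map measurable_fst.aemeasurable h1
    have h2' := ae_of_ae_map measurable_snd.aemeasurable h2
    rw [← lintegral_indicator_one (hE.prod hF)]
    refine lintegral_congr_ae ?_
    filter_upwards [h1', h2'] with p hp1 hp2
    rw [hp1, hp2]
    by_cases h1 : p.1 ∈ E <;> by_cases h2 : p.2 ∈ F <;> simp [h1, h2, indicator]

theorem isCompact_couplings {α β : Type*} [TopologicalSpace α] [PolishSpace α]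
    [MeasurableSpace α] [BorelSpace α] [TopologicalSpace β] [PolishSpace β]
    [MeasurableSpace β] [BorelSpace β] (μ : Measure α) (ν : Measure β) [IsProbabilityMeasure μ]
    [IsProbabilityMeasure ν] :
    IsCompact {P : ProbabilityMeasure (α × β) | IsCoupling (P : Measure (α × β)) μ ν} := by
  have hclosed : IsClosed
      {P : ProbabilityMeasure (α × β) | IsCoupling (P : Measure (α × β)) μ ν} := by
    have h1 : IsClosed {P : ProbabilityMeasure (α × β) |
        P.map (f := Prod.fst) measurable_fst.aemeasurable = ⟨μ, inferInstance⟩} :=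
      isClosed_eq (ProbabilityMeasure.continuous_map continuous_fst) continuous_const
    have h2 : IsClosed {P : ProbabilityMeasure (α × β) |
        P.map (f := Prod.snd) measurable_snd.aemeasurable = ⟨ν, inferInstance⟩} :=
      isClosed_eq (ProbabilityMeasure.continuous_map continuous_snd) continuous_const
    convert h1.inter h2 using 1
    ext P
    exact ⟨fun h => ⟨Subtype.ext h.1, Subtype.ext h.2⟩,
      fun h => ⟨congrArg Subtype.val h.1, congrArg Subtype.val h.2⟩⟩
  rw [← hclosed.closure_eq]
  refine isCompact_closure_of_isTightMeasureSet (IsTightMeasureSet.prodMk ?_ ?_)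
  · refine (isTightMeasureSet_singleton (μ := μ)).subset ?_
    rintro _ ⟨_, ⟨P, hP, rfl⟩, rfl⟩
    exact hP.1
  · refine (isTightMeasureSet_singleton (μ := ν)).subset ?_
    rintro _ ⟨_, ⟨P, hP, rfl⟩, rfl⟩
    exact hP.2

end Couplings

/-! ### Transport costs in terms of couplings of displacement interpolations -/

section Costs

/-- The optimal cost between image measures can be computed on the couplings of the measures. -/
theorem iInf_coupling_map {α β A B : Type*} [MeasurableSpace α] [StandardBorelSpace α]
    [Nonempty α] [MeasurableSpace β] [StandardBorelSpace β] [Nonempty β] [MeasurableSpace A]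
    [MeasurableSpace B] {f : α → A} {g : β → B} (hf : Measurable f) (hg : Measurable g)
    (μ : Measure α) (ν : Measure β) [IsProbabilityMeasure μ] [IsProbabilityMeasure ν]
    {c : A × B → ℝ≥0∞} (hc : Measurable c) :
    ⨅ (π : Measure (A × B)) (_ : IsCoupling π (μ.map f) (ν.map g)), ∫⁻ p, c p ∂π =
      ⨅ (P : Measure (α × β)) (_ : IsCoupling P μ ν), ∫⁻ p, c (f p.1, g p.2) ∂P := by
  refine le_antisymm (le_iInf₂ fun P hP => ?_) (le_iInf₂ fun π hπ => ?_)
  · refine (iInf₂_le (f := fun (π : Measure (A × B)) (_ : IsCoupling π (μ.map f) (ν.map g)) =>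
      ∫⁻ p, c p ∂π) _ (hP.map hf hg)).trans_eq ?_
    rw [lintegral_map hc (hf.prodMap hg)]
    rfl
  · obtain ⟨P, hP, rfl⟩ := exists_isCoupling_map_eq hf hg hπ
    refine (iInf₂_le (f := fun (P : Measure (α × β)) (_ : IsCoupling P μ ν) =>
      ∫⁻ p, c (f p.1, g p.2) ∂P) P hP).trans_eq ?_
    rw [lintegral_map hc (hf.prodMap hg)]
    rfl

theorem IsCoupling.lintegral_fst {A B : Type*} [MeasurableSpace A] [MeasurableSpace B]
    {π : Measure (A × B)} {μ : Measure A} {ν : Measure B} (h : IsCoupling π μ ν) {f : A → ℝ≥0∞}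
    (hf : Measurable f) : ∫⁻ p, f p.1 ∂π = ∫⁻ a, f a ∂μ := by
  rw [← h.1, lintegral_map hf measurable_fst]

theorem IsCoupling.lintegral_snd {A B : Type*} [MeasurableSpace A] [MeasurableSpace B]
    {π : Measure (A × B)} {μ : Measure A} {ν : Measure B} (h : IsCoupling π μ ν) {f : B → ℝ≥0∞}
    (hf : Measurable f) : ∫⁻ p, f p.2 ∂π = ∫⁻ b, f b ∂ν := by
  rw [← h.2, lintegral_map hf measurable_snd]

theorem ofReal_add_sq_le (a b : ℝ) :
    ENNReal.ofReal (a + b) ^ 2 ≤ 4 * (ENNReal.ofReal a ^ 2 + ENNReal.ofReal b ^ 2) := by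
  have h1 : ENNReal.ofReal (a + b) ≤ 2 * max (ENNReal.ofReal a) (ENNReal.ofReal b) := by
    refine ENNReal.ofReal_add_le.trans ?_
    rw [two_mul]
    exact add_le_add (le_max_left _ _) (le_max_right _ _)
  refine (pow_le_pow_left' h1 2).trans ?_
  rw [mul_pow, show (2 : ℝ≥0∞) ^ 2 = 4 by norm_num]
  gcongr
  rcases max_choice (ENNReal.ofReal a) (ENNReal.ofReal b) with h | h <;> rw [h]
  exacts [le_self_add, le_add_self]

theorem lintegral_ofReal_add_sq_le {α : Type*} [MeasurableSpace α] (μ : Measure α) {f g : α → ℝ}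
    (hf : Measurable f) : ∫⁻ x, ENNReal.ofReal (f x + g x) ^ 2 ∂μ ≤
      4 * (∫⁻ x, ENNReal.ofReal (f x) ^ 2 ∂μ + ∫⁻ x, ENNReal.ofReal (g x) ^ 2 ∂μ) := by
  refine (lintegral_mono fun x => ofReal_add_sq_le (f x) (g x)).trans_eq ?_
  rw [lintegral_const_mul' _ _ (by norm_num), lintegral_add_left (by fun_prop)]

theorem lintegral_dist_sq_lt_top {X : Type*} [MetricSpace X] [MeasurableSpace X]
    (μ : W2Space X) (x₀ : X) : ∫⁻ x, ENNReal.ofReal (dist x₀ x) ^ 2 ∂μ.1 < ⊤ := by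
  obtain ⟨hp, x₁, h⟩ := μ.2
  refine lt_of_le_of_lt (lintegral_mono fun x => ?_) (lt_of_le_of_lt
    (lintegral_ofReal_add_sq_le μ.1 (f := fun _ => dist x₀ x₁) (g := fun x => dist x₁ x)
      measurable_const) ?_)
  · gcongr
    exact dist_triangle _ _ _
  · rw [lintegral_const, measure_univ, mul_one]
    exact ENNReal.mul_lt_top (by norm_num) (ENNReal.add_lt_top.2 ⟨by finiteness, h⟩)

/-- A bound for the growth of a ray. -/
def rayBound {X : Type*} [MetricSpace X] (x₀ : X) (γ : RaySpace X) : ℝ :=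
  dist x₀ (γ.1 0) + raySpeed γ

section

variable {X : Type*} [MetricSpace X]

theorem rayBound_nonneg (x₀ : X) (γ : RaySpace X) : 0 ≤ rayBound x₀ γ := by
  unfold rayBound; positivity

theorem continuous_rayBound (x₀ : X) : Continuous (rayBound x₀) :=
  (continuous_const.dist (continuous_rayEval 0)).add
    (NNReal.continuous_coe.comp continuous_raySpeed)

theorem continuous_dist_rayEval (t : ℝ≥0) :
    Continuous fun p : RaySpace X × RaySpace X => dist (p.1.1 t) (p.2.1 t) :=
  ((continuous_rayEval t).comp continuous_fst).dist ((continuous_rayEval t).comp continuous_snd)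

theorem dist_ray_div_le (x₀ : X) (γ β : RaySpace X) {t : ℝ≥0} (ht : 1 ≤ t) :
    dist (γ.1 t) (β.1 t) / t ≤ rayBound x₀ γ + rayBound x₀ β := by
  have ht' : (1 : ℝ) ≤ t := ht
  have hb : ∀ γ : RaySpace X, dist x₀ (γ.1 t) ≤ t * rayBound x₀ γ := fun γ => by
    refine (dist_triangle _ (γ.1 0) _).trans ?_
    have h : dist (γ.1 0) (γ.1 t) = raySpeed γ * t := by rw [dist_ray]; simp
    rw [h, rayBound, mul_add, mul_comm (t : ℝ) (raySpeed γ)]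
    gcongr
    exact le_mul_of_one_le_left dist_nonneg ht'
  rw [div_le_iff₀ (by linarith)]
  linarith [dist_triangle_left (γ.1 t) (β.1 t) x₀, hb γ, hb β]

end

section

variable {X : Type*} [MetricSpace X] [MeasurableSpace X] {μ σ : Measure (RaySpace X)}
  {P : Measure (RaySpace X × RaySpace X)}

/-- The transport cost at time `t`, normalized by `t ^ 2`, of a coupling of two measures on the
space of rays. -/
def scaledCost (P : Measure (RaySpace X × RaySpace X)) (t : ℝ≥0) : ℝ≥0∞ :=
  ∫⁻ p, ENNReal.ofReal (dist (p.1.1 t) (p.2.1 t) / t) ^ 2 ∂P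

/-- The transport cost at infinity of a coupling of two measures on the space of rays. -/
def endCost (P : Measure (RaySpace X × RaySpace X)) : ℝ≥0∞ :=
  ∫⁻ p, ENNReal.ofReal (coneDist (rayEnd p.1) (rayEnd p.2)) ^ 2 ∂P

/-- The optimal transport cost at time `t`, normalized by `t ^ 2`, between the evaluations of two
measures on the space of rays. -/
def optScaledCost (μ σ : Measure (RaySpace X)) (t : ℝ≥0) : ℝ≥0∞ :=
  ⨅ (P : Measure (RaySpace X × RaySpace X)) (_ : IsCoupling P μ σ), scaledCost P t

/-- The optimal transport cost at infinity between two measures on the space of rays. -/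
def optEndCost (μ σ : Measure (RaySpace X)) : ℝ≥0∞ :=
  ⨅ (P : Measure (RaySpace X × RaySpace X)) (_ : IsCoupling P μ σ), endCost P

theorem optScaledCost_le (hP : IsCoupling P μ σ) (t : ℝ≥0) :
    optScaledCost μ σ t ≤ scaledCost P t :=
  iInf₂_le (f := fun (P : Measure (RaySpace X × RaySpace X)) (_ : IsCoupling P μ σ) =>
    scaledCost P t) P hP

theorem optEndCost_le (hP : IsCoupling P μ σ) : optEndCost μ σ ≤ endCost P :=
  iInf₂_le (f := fun (P : Measure (RaySpace X × RaySpace X)) (_ : IsCoupling P μ σ) =>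
    endCost P) P hP

end

variable {X : Type*} [MetricSpace X] [MeasurableSpace X] [BorelSpace X]
  [SecondCountableTopology X] {x₀ : X} {μ σ : Measure (RaySpace X)}
  {P : Measure (RaySpace X × RaySpace X)}

theorem lintegral_rayBound_lt_top (x₀ : X) (m₀ m₁ : W2Space X) (h₀ : μ.map (rayEval 0) = m₀.1)
    (h₁ : μ.map (rayEval 1) = m₁.1) : ∫⁻ γ, ENNReal.ofReal (rayBound x₀ γ) ^ 2 ∂μ < ⊤ := by
  have hm : ∀ t, Measurable fun γ : RaySpace X => dist x₀ (γ.1 t) := fun t =>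
    (continuous_const.dist (continuous_rayEval t)).measurable
  have hd : Measurable fun x : X => ENNReal.ofReal (dist x₀ x) ^ 2 := by fun_prop
  have h0 : ∫⁻ γ, ENNReal.ofReal (dist x₀ (γ.1 0)) ^ 2 ∂μ < ⊤ := by
    have := lintegral_dist_sq_lt_top m₀ x₀
    rwa [← h₀, lintegral_map hd (continuous_rayEval 0).measurable] at this
  have h1 : ∫⁻ γ, ENNReal.ofReal (dist x₀ (γ.1 1)) ^ 2 ∂μ < ⊤ := by
    have := lintegral_dist_sq_lt_top m₁ x₀
    rwa [← h₁, lintegral_map hd (continuous_rayEval 1).measurable] at this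
  have h2 := lintegral_ofReal_add_sq_le μ (f := fun γ => dist x₀ (γ.1 0))
    (g := fun γ => dist x₀ (γ.1 1)) (hm 0)
  have h3 := lintegral_ofReal_add_sq_le μ (f := fun γ => dist x₀ (γ.1 0))
    (g := fun γ => dist x₀ (γ.1 0) + dist x₀ (γ.1 1)) (hm 0)
  refine lt_of_le_of_lt (lintegral_mono fun γ => ?_) (h3.trans_lt ?_)
  · gcongr
    rw [rayBound, raySpeed, coe_nndist]
    gcongr
    exact dist_triangle_left _ _ _
  · have h2' := h2.trans_lt (ENNReal.mul_lt_top (by norm_num) (ENNReal.add_lt_top.2 ⟨h0, h1⟩))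
    exact ENNReal.mul_lt_top (by norm_num) (ENNReal.add_lt_top.2 ⟨h0, h2'⟩)

theorem IsCoupling.lintegral_rayBound_le (hP : IsCoupling P μ σ) (x₀ : X) :
    ∫⁻ p, ENNReal.ofReal (rayBound x₀ p.1 + rayBound x₀ p.2) ^ 2 ∂P ≤
      4 * (∫⁻ γ, ENNReal.ofReal (rayBound x₀ γ) ^ 2 ∂μ
        + ∫⁻ γ, ENNReal.ofReal (rayBound x₀ γ) ^ 2 ∂σ) := by
  have hm : Measurable (rayBound (X := X) x₀) := (continuous_rayBound x₀).measurable
  refine (lintegral_ofReal_add_sq_le P (hm.comp measurable_fst)).trans_eq ?_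
  have h : Measurable fun γ : RaySpace X => ENNReal.ofReal (rayBound x₀ γ) ^ 2 := by fun_prop
  rw [← hP.lintegral_fst h, ← hP.lintegral_snd h]
  rfl

variable [CompleteSpace X]

theorem tendsto_scaledCost (hX : IsHadamard X) (hP : IsCoupling P μ σ)
    (hμ : ∫⁻ γ, ENNReal.ofReal (rayBound x₀ γ) ^ 2 ∂μ < ⊤)
    (hσ : ∫⁻ γ, ENNReal.ofReal (rayBound x₀ γ) ^ 2 ∂σ < ⊤) :
    Tendsto (scaledCost P) atTop (𝓝 (endCost P)) := by
  refine tendsto_lintegral_filter_of_dominated_convergence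
    (fun p => ENNReal.ofReal (rayBound x₀ p.1 + rayBound x₀ p.2) ^ 2) ?_ ?_ ?_ ?_
  · refine Eventually.of_forall fun t => ?_
    have := (continuous_dist_rayEval (X := X) t).measurable
    fun_prop
  · filter_upwards [eventually_ge_atTop 1] with t ht
    refine Eventually.of_forall fun p => ?_
    gcongr
    exact dist_ray_div_le x₀ _ _ ht
  · exact ((hP.lintegral_rayBound_le x₀).trans_lt
      (ENNReal.mul_lt_top (by norm_num) (ENNReal.add_lt_top.2 ⟨hμ, hσ⟩))).ne
  · refine Eventually.of_forall fun p => ?_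
    exact ((ENNReal.continuous_pow 2).comp ENNReal.continuous_ofReal).tendsto _ |>.comp
      (hX.tendsto_dist_div_coneDist p.1 p.2)

theorem W2cost_map_rayEval [IsProbabilityMeasure μ] [IsProbabilityMeasure σ] {t : ℝ≥0}
    (ht : 0 < t) : W2cost (μ.map (rayEval t)) (σ.map (rayEval t)) =
      (t : ℝ≥0∞) ^ 2 * optScaledCost μ σ t := by
  have : Nonempty (RaySpace X) := nonempty_of_isProbabilityMeasure μ
  have h0 : (t : ℝ≥0∞) ^ 2 ≠ 0 := pow_ne_zero _ (by exact_mod_cast ht.ne')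
  have h1 : (t : ℝ≥0∞) ^ 2 ≠ ⊤ := by finiteness
  rw [W2cost, optScaledCost, iInf_coupling_map (continuous_rayEval t).measurable
    (continuous_rayEval t).measurable μ σ (c := fun p => ENNReal.ofReal (dist p.1 p.2) ^ 2) (by fun_prop),
    ENNReal.mul_iInf_of_ne h0 h1]
  refine iInf_congr fun P => ?_
  rw [ENNReal.mul_iInf_of_ne h0 h1]
  refine iInf_congr fun hP => ?_
  rw [scaledCost, ← lintegral_const_mul' _ _ h1]
  refine lintegral_congr fun p => ?_
  have ht' : (t : ℝ) ≠ 0 := by exact_mod_cast ht.ne'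
  rw [← mul_pow, ← ENNReal.ofReal_coe_nnreal, ← ENNReal.ofReal_mul t.coe_nonneg,
    mul_div_cancel₀ _ ht']
  rfl

theorem Winfty_map_rayEnd (hX : IsHadamard X) (x₀ : X) (μ σ : Measure (RaySpace X))
    [IsProbabilityMeasure μ] [IsProbabilityMeasure σ] :
    Winfty (μ.map rayEnd) (σ.map rayEnd) =
      Real.sqrt (optEndCost μ σ).toReal := by
  have : Nonempty (RaySpace X) := nonempty_of_isProbabilityMeasure μ
  have hc := measurable_coneDist hX x₀
  rw [Winfty, iInf_coupling_map measurable_rayEnd measurable_rayEnd μ σ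
    (c := fun p => ENNReal.ofReal (coneDist p.1 p.2) ^ 2) (by fun_prop)]
  rfl

end Costs

/-! ### Lower semicontinuity of the asymptotic cost -/

section LowerBound

theorem ofReal_add_div_sq_le {a c t : ℝ} (ha : 0 ≤ a) (hc : 0 ≤ c) (ht : 1 ≤ t) :
    ENNReal.ofReal (a + c / t) ^ 2 ≤
      ENNReal.ofReal (1 + 1 / t) * ENNReal.ofReal a ^ 2
        + ENNReal.ofReal (2 / t) * ENNReal.ofReal c ^ 2 := by
  have ht0 : 0 < t := by linarith
  rw [← ENNReal.ofReal_pow (by positivity), ← ENNReal.ofReal_pow ha, ← ENNReal.ofReal_pow hc,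
    ← ENNReal.ofReal_mul (by positivity), ← ENNReal.ofReal_mul (by positivity),
    ← ENNReal.ofReal_add (by positivity) (by positivity)]
  refine ENNReal.ofReal_le_ofReal ?_
  have hu : 1 / t ≤ 1 := (div_le_one ht0).2 ht
  have hu0 : 0 < 1 / t := by positivity
  rw [← mul_one_div c t, ← mul_one_div 2 t]
  generalize 1 / t = u at hu hu0
  nlinarith [mul_nonneg hu0.le (sq_nonneg (a - c)),
    mul_nonneg (mul_nonneg hu0.le (sub_nonneg.2 hu)) (sq_nonneg c)]

section

variable {X : Type*} [MetricSpace X]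

theorem continuous_dist_straighten (hX : IsHadamard X) (x₀ : X) (s : ℝ≥0) :
    Continuous fun p : RaySpace X × RaySpace X =>
      dist ((straighten hX x₀ p.1).1 s) ((straighten hX x₀ p.2).1 s) :=
  (continuous_dist_rayEval s).comp ((continuous_straighten hX x₀).prodMap
    (continuous_straighten hX x₀))

theorem dist_straighten_div_le (hX : IsHadamard X) (x₀ : X) (γ β : RaySpace X) {s t : ℝ≥0}
    (hs : 0 < s) (hst : s ≤ t) :
    dist ((straighten hX x₀ γ).1 s) ((straighten hX x₀ β).1 s) / s ≤
      dist (γ.1 t) (β.1 t) / t + (rayBound x₀ γ + rayBound x₀ β) / t := by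
  have hs' : (0 : ℝ) < s := hs
  have ht' : (0 : ℝ) < t := hs.trans_le hst
  rw [div_le_iff₀ hs', ← add_div, div_mul_eq_mul_div, mul_comm, ← div_mul_eq_mul_div]
  refine (dist_straighten_le hX x₀ γ β (hs.trans_le hst) hst).trans ?_
  rw [add_assoc, rayBound, rayBound]
  gcongr <;> simp

/-- A truncated transport cost, as a bounded continuous function. -/
def truncatedCost (hX : IsHadamard X) (x₀ : X) (s M : ℝ≥0) :
    BoundedContinuousFunction (RaySpace X × RaySpace X) ℝ≥0 :=
  BoundedContinuousFunction.mkOfBound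
    ⟨fun p => min (Real.toNNReal
      (dist ((straighten hX x₀ p.1).1 s) ((straighten hX x₀ p.2).1 s) / s) ^ 2) M, by
      have := continuous_dist_straighten hX x₀ s
      fun_prop⟩ M fun p q => by
      refine abs_sub_le_of_nonneg_of_le (NNReal.coe_nonneg _) ?_ (NNReal.coe_nonneg _) ?_ <;>
      exact NNReal.coe_le_coe.2 (min_le_right _ _)

theorem coe_truncatedCost (hX : IsHadamard X) (x₀ : X) (s M : ℝ≥0)
    (p : RaySpace X × RaySpace X) : (truncatedCost hX x₀ s M p : ℝ≥0∞) =
      min (ENNReal.ofReal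
        (dist ((straighten hX x₀ p.1).1 s) ((straighten hX x₀ p.2).1 s) / s) ^ 2) M := by
  rw [ENNReal.ofReal, ← ENNReal.coe_pow, ← ENNReal.coe_min]
  rfl

theorem tendsto_truncatedCost (hX : IsHadamard X) (x₀ : X) (p : RaySpace X × RaySpace X) :
    Tendsto (fun n : ℕ => (truncatedCost hX x₀ (n + 1) n p : ℝ≥0∞)) atTop
      (𝓝 (ENNReal.ofReal (coneDist (rayEnd p.1) (rayEnd p.2)) ^ 2)) := by
  have h1 := hX.tendsto_dist_div_coneDist (straighten hX x₀ p.1) (straighten hX x₀ p.2)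
  rw [rayEnd_straighten, rayEnd_straighten] at h1
  have h2 : Tendsto (fun n : ℕ => (n + 1 : ℝ≥0)) atTop atTop :=
    tendsto_atTop_mono (fun n => le_self_add) (tendsto_natCast_atTop_atTop (R := ℝ≥0))
  have h3 : Tendsto (fun t : ℝ≥0 => ENNReal.ofReal
      (dist ((straighten hX x₀ p.1).1 t) ((straighten hX x₀ p.2).1 t) / t) ^ 2) atTop
      (𝓝 (ENNReal.ofReal (coneDist (rayEnd p.1) (rayEnd p.2)) ^ 2)) :=
    (((ENNReal.continuous_pow 2).comp ENNReal.continuous_ofReal).tendsto _).comp h1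
  have h4 : Tendsto (fun n : ℕ => ((n : ℝ≥0) : ℝ≥0∞)) atTop (𝓝 ⊤) := by
    simpa using ENNReal.tendsto_nat_nhds_top
  have h5 := (h3.comp h2).min h4
  rw [min_top_right] at h5
  refine h5.congr fun n => ?_
  rw [coe_truncatedCost]
  rfl

end

variable {X : Type*} [MetricSpace X] [MeasurableSpace X] [BorelSpace X]
  [SecondCountableTopology X] [CompleteSpace X] {μ σ : Measure (RaySpace X)}
  {P : Measure (RaySpace X × RaySpace X)}

theorem IsCoupling.scaledCost_straighten_le (hX : IsHadamard X) (x₀ : X) (hP : IsCoupling P μ σ)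
    {s t : ℝ≥0} (hs : 0 < s) (hst : s ≤ t) (ht : 1 ≤ t) :
    ∫⁻ p, ENNReal.ofReal
        (dist ((straighten hX x₀ p.1).1 s) ((straighten hX x₀ p.2).1 s) / s) ^ 2 ∂P ≤
      ENNReal.ofReal (1 + 1 / t) * scaledCost P t + ENNReal.ofReal (2 / t) *
        (4 * (∫⁻ γ, ENNReal.ofReal (rayBound x₀ γ) ^ 2 ∂μ
          + ∫⁻ γ, ENNReal.ofReal (rayBound x₀ γ) ^ 2 ∂σ)) := by
  have hm : Measurable fun p : RaySpace X × RaySpace X => dist (p.1.1 t) (p.2.1 t) :=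
    (continuous_dist_rayEval t).measurable
  calc _ ≤ ∫⁻ p, (ENNReal.ofReal (1 + 1 / t) * ENNReal.ofReal (dist (p.1.1 t) (p.2.1 t) / t) ^ 2
        + ENNReal.ofReal (2 / t) * ENNReal.ofReal (rayBound x₀ p.1 + rayBound x₀ p.2) ^ 2) ∂P := by
        refine lintegral_mono fun p => le_trans ?_ (ofReal_add_div_sq_le (by positivity)
          (add_nonneg (rayBound_nonneg x₀ p.1) (rayBound_nonneg x₀ p.2)) ht)
        gcongr
        exact dist_straighten_div_le hX x₀ p.1 p.2 hs hst
    _ = ENNReal.ofReal (1 + 1 / t) * scaledCost P t + ENNReal.ofReal (2 / t) *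
        ∫⁻ p, ENNReal.ofReal (rayBound x₀ p.1 + rayBound x₀ p.2) ^ 2 ∂P := by
        rw [lintegral_add_left (by fun_prop), lintegral_const_mul' _ _ ENNReal.ofReal_ne_top,
          lintegral_const_mul' _ _ ENNReal.ofReal_ne_top, scaledCost]
    _ ≤ _ := by
        gcongr
        exact hP.lintegral_rayBound_le x₀

variable [IsProbabilityMeasure μ] [IsProbabilityMeasure σ]

/-- Couplings that are almost optimal at arbitrarily large times accumulate to a coupling which is
at least as good at infinity. -/
theorem exists_isCoupling_endCost_le (hX : IsHadamard X) (x₀ : X)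
    (hμ : ∫⁻ γ, ENNReal.ofReal (rayBound x₀ γ) ^ 2 ∂μ < ⊤)
    (hσ : ∫⁻ γ, ENNReal.ofReal (rayBound x₀ γ) ^ 2 ∂σ < ⊤)
    {F : Filter ℝ≥0} [F.NeBot] (hF : F ≤ atTop) {b : ℝ≥0 → ℝ≥0∞} {L : ℝ≥0∞}
    (hb : Tendsto b F (𝓝 L))
    (h : ∀ᶠ t in F, optScaledCost μ σ t < b t) :
    ∃ P : Measure (RaySpace X × RaySpace X), IsCoupling P μ σ ∧ endCost P ≤ L := by
  have h' : ∀ t, ∃ P : ProbabilityMeasure (RaySpace X × RaySpace X),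
      IsCoupling (P : Measure (RaySpace X × RaySpace X)) μ σ ∧
      (optScaledCost μ σ t < b t →
        scaledCost (P : Measure (RaySpace X × RaySpace X)) t ≤ b t) := fun t => by
    by_cases ht : optScaledCost μ σ t < b t
    · obtain ⟨P, hP, hPt⟩ := by simpa only [optScaledCost, iInf_lt_iff] using ht
      exact ⟨⟨P, hP.isProbabilityMeasure⟩, hP, fun _ => hPt.le⟩
    · exact ⟨⟨μ.prod σ, inferInstance⟩, isCoupling_prod μ σ, fun h => absurd h ht⟩
  choose Q hQ hQb using h'
  let U := Ultrafilter.of F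
  have hU : (U : Filter ℝ≥0) ≤ F := Ultrafilter.of_le F
  obtain ⟨P, hP, hlim⟩ := (isCompact_couplings μ σ).ultrafilter_le_nhds' (U.map Q)
    (Eventually.of_forall hQ : ∀ᶠ t in (U : Filter ℝ≥0), _)
  have hlim' : Tendsto Q U (𝓝 P) := hlim
  set D := 4 * (∫⁻ γ, ENNReal.ofReal (rayBound x₀ γ) ^ 2 ∂μ
    + ∫⁻ γ, ENNReal.ofReal (rayBound x₀ γ) ^ 2 ∂σ)
  have hD : D ≠ ⊤ := (ENNReal.mul_lt_top (by norm_num) (ENNReal.add_lt_top.2 ⟨hμ, hσ⟩)).ne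
  have key : ∀ n : ℕ, ∫⁻ p, truncatedCost hX x₀ (n + 1) n p
      ∂(P : Measure (RaySpace X × RaySpace X)) ≤ L := fun n => by
    have hinv : Tendsto (fun t : ℝ≥0 => 1 / (t : ℝ)) U (𝓝 0) := by
      simp only [one_div]
      exact (tendsto_inv_atTop_zero.comp (NNReal.tendsto_coe_atTop.2 tendsto_id)).mono_left
        (hU.trans hF)
    have h1 : Tendsto (fun t : ℝ≥0 => ENNReal.ofReal (1 + 1 / t) * b t
        + ENNReal.ofReal (2 * (1 / t)) * D) U
        (𝓝 (ENNReal.ofReal (1 + 0) * L + ENNReal.ofReal (2 * 0) * D)) := by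
      refine (ENNReal.Tendsto.mul ?_ (.inl (by simp)) (hb.mono_left hU) (.inr (by simp))).add
        (ENNReal.Tendsto.mul_const ?_ (.inr hD))
      · exact (ENNReal.continuous_ofReal.tendsto _).comp (hinv.const_add 1)
      · exact (ENNReal.continuous_ofReal.tendsto _).comp (hinv.const_mul 2)
    simp only [add_zero, ENNReal.ofReal_one, one_mul, mul_zero, ENNReal.ofReal_zero,
      zero_mul] at h1
    refine le_of_tendsto_of_tendsto
      (ProbabilityMeasure.tendsto_iff_forall_lintegral_tendsto.1 hlim' _) h1 ?_
    filter_upwards [hU h, hU (hF (eventually_ge_atTop (n + 1 : ℝ≥0)))] with t ht htn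
    have h2 := (hQ t).scaledCost_straighten_le hX x₀ (by positivity) htn
      (le_add_self.trans htn)
    refine (lintegral_mono fun p => ?_).trans (h2.trans ?_)
    · rw [coe_truncatedCost]
      exact min_le_left _ _
    · rw [mul_one_div]
      gcongr
      exact hQb t ht
  refine ⟨P, hP, ?_⟩
  calc endCost (P : Measure (RaySpace X × RaySpace X))
      = ∫⁻ p, liminf (fun n : ℕ => (truncatedCost hX x₀ (n + 1) n p : ℝ≥0∞)) atTop ∂P :=
        lintegral_congr fun p => (tendsto_truncatedCost hX x₀ p).liminf_eq.symm
    _ ≤ liminf (fun n : ℕ => ∫⁻ p, truncatedCost hX x₀ (n + 1) n p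
        ∂(P : Measure (RaySpace X × RaySpace X))) atTop :=
        lintegral_liminf_le fun n => by
          have := (truncatedCost hX x₀ (n + 1) n).continuous.measurable
          fun_prop
    _ ≤ L := (liminf_le_liminf (Eventually.of_forall key)).trans_eq (liminf_const L)

end LowerBound

/-! ### The asymptotic formula -/

section AsymptoticFormula

variable {X : Type*} [MetricSpace X] [MeasurableSpace X] [BorelSpace X]
  [SecondCountableTopology X] {μ σ : Measure (RaySpace X)}
  {P : Measure (RaySpace X × RaySpace X)}

theorem IsCoupling.scaledCost_le (hP : IsCoupling P μ σ) (x₀ : X) {t : ℝ≥0} (ht : 1 ≤ t) :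
    scaledCost P t ≤ 4 * (∫⁻ γ, ENNReal.ofReal (rayBound x₀ γ) ^ 2 ∂μ
        + ∫⁻ γ, ENNReal.ofReal (rayBound x₀ γ) ^ 2 ∂σ) := by
  refine (lintegral_mono fun p => ?_).trans (hP.lintegral_rayBound_le x₀)
  gcongr
  exact dist_ray_div_le x₀ _ _ ht

theorem IsCoupling.map_rayEnd_eq (hX : IsHadamard X) (x₀ : X) (hP : IsCoupling P μ σ)
    (h : endCost P = 0) : μ.map rayEnd = σ.map rayEnd := by
  have hc := measurable_coneDist hX x₀
  have hm := measurable_rayEnd (X := X)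
  rw [endCost, lintegral_eq_zero_iff (by fun_prop)] at h
  rw [← hP.1, ← hP.2, Measure.map_map hm measurable_fst, Measure.map_map hm measurable_snd]
  refine Measure.map_congr ?_
  filter_upwards [h] with p hp
  have h0 : coneDist (rayEnd p.1) (rayEnd p.2) = 0 := by
    refine le_antisymm ?_ (coneDist_nonneg _ _)
    simpa using hp
  rw [Function.comp_apply, Function.comp_apply, ← rayEnd_straighten hX x₀ p.1,
    straighten_eq_of_coneDist_eq_zero hX x₀ h0, rayEnd_straighten]

variable [CompleteSpace X] [IsProbabilityMeasure μ] [IsProbabilityMeasure σ]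

theorem exists_isCoupling_coneDist_eq_zero (hX : IsHadamard X) (x₀ : X)
    (h : μ.map rayEnd = σ.map rayEnd) : ∃ P : Measure (RaySpace X × RaySpace X),
      IsCoupling P μ σ ∧ ∀ᵐ p ∂P, coneDist (rayEnd p.1) (rayEnd p.2) = 0 := by
  have : Nonempty (RaySpace X) := nonempty_of_isProbabilityMeasure μ
  have hm := measurable_rayEnd (X := X)
  have hdiag : Measurable fun c : Cone (Boundary X) => (c, c) := measurable_id.prodMk measurable_id
  have hπ : IsCoupling ((μ.map rayEnd).map fun c => (c, c)) (μ.map rayEnd) (σ.map rayEnd) := by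
    constructor
    · rw [Measure.map_map measurable_fst hdiag]
      exact Measure.map_id
    · rw [Measure.map_map measurable_snd hdiag, ← h]
      exact Measure.map_id
  obtain ⟨P, hP, hPπ⟩ := exists_isCoupling_map_eq hm hm hπ
  refine ⟨P, hP, ?_⟩
  have hs : MeasurableSet {c : Cone (Boundary X) × Cone (Boundary X) | coneDist c.1 c.2 = 0} :=
    measurable_coneDist hX x₀ (measurableSet_singleton 0)
  have h1 : ∀ᵐ c ∂P.map (Prod.map rayEnd rayEnd), coneDist c.1 c.2 = 0 := by
    rw [hPπ, ae_map_iff hdiag.aemeasurable hs]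
    exact Eventually.of_forall fun c => coneDist_self hX x₀ c
  exact (ae_map_iff (hm.prodMap hm).aemeasurable hs).1 h1

theorem W2cost_map_rayEval_le (hX : IsHadamard X) (x₀ : X) (h : μ.map rayEnd = σ.map rayEnd)
    (t : ℝ≥0) : W2cost (μ.map (rayEval t)) (σ.map (rayEval t)) ≤
      4 * (∫⁻ γ, ENNReal.ofReal (rayBound x₀ γ) ^ 2 ∂μ
        + ∫⁻ γ, ENNReal.ofReal (rayBound x₀ γ) ^ 2 ∂σ) := by
  obtain ⟨P, hP, h0⟩ := exists_isCoupling_coneDist_eq_zero hX x₀ h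
  have hm := (continuous_rayEval (X := X) t).measurable
  refine (iInf₂_le (f := fun (π : Measure (X × X))
    (_ : IsCoupling π (μ.map (rayEval t)) (σ.map (rayEval t))) =>
      ∫⁻ p, ENNReal.ofReal (dist p.1 p.2) ^ 2 ∂π) _ (hP.map hm hm)).trans ?_
  rw [lintegral_map (by fun_prop) (hm.prodMap hm)]
  refine (lintegral_mono_ae ?_).trans (hP.lintegral_rayBound_le x₀)
  filter_upwards [h0] with p hp
  gcongr
  have h1 := dist_straighten_self_le hX x₀ p.1 t
  have h2 := dist_straighten_self_le hX x₀ p.2 t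
  rw [← straighten_eq_of_coneDist_eq_zero hX x₀ hp] at h2
  have h3 : ∀ γ : RaySpace X, dist x₀ (γ.1 0) ≤ rayBound x₀ γ := fun γ =>
    le_add_of_nonneg_right (NNReal.coe_nonneg _)
  exact (dist_triangle_left _ _ _).trans (add_le_add (h1.trans (h3 _)) (h2.trans (h3 _)))

theorem tendsto_optScaledCost (hX : IsHadamard X) (x₀ : X)
    (hμ : ∫⁻ γ, ENNReal.ofReal (rayBound x₀ γ) ^ 2 ∂μ < ⊤)
    (hσ : ∫⁻ γ, ENNReal.ofReal (rayBound x₀ γ) ^ 2 ∂σ < ⊤) :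
    Tendsto (optScaledCost μ σ) atTop (𝓝 (optEndCost μ σ)) := by
  refine tendsto_of_le_liminf_of_limsup_le (le_of_forall_gt fun b hb => ?_)
    (le_iInf₂ fun P hP => ?_)
  · obtain ⟨b', hb', hbb⟩ := exists_between hb
    have hfreq : ∃ᶠ t in atTop, optScaledCost μ σ t < b' :=
      frequently_lt_of_liminf_lt (by isBoundedDefault) hb'
    have : (atTop ⊓ 𝓟 {t | optScaledCost μ σ t < b'}).NeBot := by
      rwa [← frequently_mem_iff_neBot]
    obtain ⟨P, hP, hPb⟩ := exists_isCoupling_endCost_le hX x₀ hμ hσ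
      (F := atTop ⊓ 𝓟 {t | optScaledCost μ σ t < b'}) inf_le_left
      (tendsto_const_nhds (x := b')) (mem_inf_of_right (mem_principal_self _))
    exact ((optEndCost_le hP).trans hPb).trans_lt hbb
  · rw [← (tendsto_scaledCost hX hP hμ hσ).limsup_eq]
    exact limsup_le_limsup (Eventually.of_forall fun t => optScaledCost_le hP t)

theorem map_rayEnd_eq_of_W2cost_le (hX : IsHadamard X) (x₀ : X)
    (hμ : ∫⁻ γ, ENNReal.ofReal (rayBound x₀ γ) ^ 2 ∂μ < ⊤)
    (hσ : ∫⁻ γ, ENNReal.ofReal (rayBound x₀ γ) ^ 2 ∂σ < ⊤) {C : ℝ}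
    (h : ∀ᶠ t in atTop, W2cost (μ.map (rayEval t)) (σ.map (rayEval t)) ≤ ENNReal.ofReal (C ^ 2)) :
    μ.map rayEnd = σ.map rayEnd := by
  have hb : Tendsto (fun t : ℝ≥0 => ENNReal.ofReal ((C ^ 2 + 1) * (1 / (t : ℝ)) ^ 2)) atTop
      (𝓝 0) := by
    have h1 : Tendsto (fun t : ℝ≥0 => 1 / (t : ℝ)) atTop (𝓝 0) := by
      simp only [one_div]
      exact tendsto_inv_atTop_zero.comp (NNReal.tendsto_coe_atTop.2 tendsto_id)
    simpa [Function.comp_def] using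
      (ENNReal.continuous_ofReal.tendsto _).comp ((h1.pow 2).const_mul (C ^ 2 + 1))
  obtain ⟨P, hP, hP0⟩ := exists_isCoupling_endCost_le hX x₀ hμ hσ le_rfl hb (by
    filter_upwards [h, eventually_gt_atTop 0] with t ht ht0
    have ht' : (t : ℝ) ≠ 0 := by exact_mod_cast ht0.ne'
    rw [W2cost_map_rayEval ht0] at ht
    refine lt_of_mul_lt_mul_left' (a := (t : ℝ≥0∞) ^ 2) (ht.trans_lt ?_)
    rw [← ENNReal.ofReal_coe_nnreal, ← ENNReal.ofReal_pow t.coe_nonneg,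
      ← ENNReal.ofReal_mul (by positivity), show (t : ℝ) ^ 2 * ((C ^ 2 + 1) * (1 / t) ^ 2) =
        C ^ 2 + 1 by field_simp]
    exact (ENNReal.ofReal_lt_ofReal_iff (by positivity)).2 (lt_add_one _))
  exact hP.map_rayEnd_eq hX x₀ (nonpos_iff_eq_zero.1 hP0)

end AsymptoticFormula

/-- **Statement 4.** The asymptotic formula: two geodesic rays of `W₂(X)` are asymptotic iff
their asymptotic measures agree, and `W(μ_t, σ_t)/t` converges to the `W_∞` distance
(for the cost `d_∞²`) between the asymptotic measures. -/
theorem asymptotic_formula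
    (X : Type*) [MetricSpace X] [MeasurableSpace X] [BorelSpace X] (hX : IsHadamard X)
    (μt σt : ℝ≥0 → W2Space X) (vμ vσ : ℝ) (hvμ : 0 ≤ vμ) (hvσ : 0 ≤ vσ)
    (hμray : ∀ s t : ℝ≥0, Wdist (μt s) (μt t) = vμ * dist s t)
    (hσray : ∀ s t : ℝ≥0, Wdist (σt s) (σt t) = vσ * dist s t)
    (μ σ : Measure (RaySpace X))
    (hμp : IsProbabilityMeasure μ) (hσp : IsProbabilityMeasure σ)
    (hμint : ∀ t : ℝ≥0, μ.map (rayEval t) = (μt t).1)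
    (hσint : ∀ t : ℝ≥0, σ.map (rayEval t) = (σt t).1) :
    ((∃ C : ℝ, ∀ t : ℝ≥0, Wdist (μt t) (σt t) ≤ C) ↔ μ.map rayEnd = σ.map rayEnd) ∧
    Filter.Tendsto (fun t : ℝ≥0 => Wdist (μt t) (σt t) / (t : ℝ)) Filter.atTop
      (nhds (Winfty (μ.map rayEnd) (σ.map rayEnd))) := by
  have := hX.complete
  have := hX.separable
  have : SecondCountableTopology X := UniformSpace.secondCountable_of_separable X
  obtain ⟨-, x₀, -⟩ := (μt 0).2
  have hμ := lintegral_rayBound_lt_top x₀ (μt 0) (μt 1) (hμint 0) (hμint 1)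
  have hσ := lintegral_rayBound_lt_top x₀ (σt 0) (σt 1) (hσint 0) (hσint 1)
  have hD := ENNReal.mul_lt_top (a := 4) (by norm_num) (ENNReal.add_lt_top.2 ⟨hμ, hσ⟩)
  have hv : ∀ t : ℝ≥0, 1 ≤ t → optScaledCost μ σ t ≤ _ := fun t ht =>
    (optScaledCost_le (isCoupling_prod μ σ) t).trans ((isCoupling_prod μ σ).scaledCost_le x₀ ht)
  have hlim := tendsto_optScaledCost (μ := μ) (σ := σ) hX x₀ hμ hσ
  have htop : optEndCost μ σ ≠ ⊤ :=
    ((le_of_tendsto hlim (eventually_atTop.2 ⟨1, hv⟩)).trans_lt hD).ne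
  simp only [Wdist, ← hμint, ← hσint]
  refine ⟨⟨fun ⟨C, hC⟩ => ?_, fun h => ⟨_, fun t => Real.sqrt_le_sqrt
    (ENNReal.toReal_mono hD.ne (W2cost_map_rayEval_le hX x₀ h t))⟩⟩, ?_⟩
  · refine map_rayEnd_eq_of_W2cost_le hX x₀ hμ hσ (C := C) ?_
    filter_upwards [eventually_ge_atTop 1] with t ht
    have hfin : W2cost (μ.map (rayEval t)) (σ.map (rayEval t)) ≠ ⊤ := by
      rw [W2cost_map_rayEval (one_pos.trans_le ht)]
      exact ENNReal.mul_ne_top (by finiteness) ((hv t ht).trans_lt hD).ne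
    rw [← ENNReal.ofReal_toReal hfin]
    exact ENNReal.ofReal_le_ofReal (Real.sqrt_le_iff.1 (hC t)).2
  · rw [Winfty_map_rayEnd hX x₀]
    refine ((Real.continuous_sqrt.tendsto _).comp
      ((ENNReal.tendsto_toReal htop).comp hlim)).congr' ?_
    filter_upwards [eventually_gt_atTop 0] with t ht
    have ht' : (t : ℝ) ≠ 0 := by exact_mod_cast ht.ne'
    rw [W2cost_map_rayEval ht, ENNReal.toReal_mul, ENNReal.toReal_pow, ENNReal.coe_toReal,
      Real.sqrt_mul (by positivity), Real.sqrt_sq t.coe_nonneg, mul_div_cancel_left₀ _ ht']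
    rfl

end
end

section
/- Let X be a Hadamard space. Every geodesic ray (μ_t)_{t≥0} of W₂(X) admits a displacement interpolation: there exists a probability measure μ on the space R(X) of geodesic rays of X such that (e_t)_#μ = μ_t for all t ≥ 0, where e_t(γ) = γ_t. -/
open MeasureTheory Filter Set Topology
open scoped NNReal ENNReal

noncomputable section


namespace MeasureTheory.Measure

open ProbabilityTheory

/-- Composing with a kernel that depends on a point only through a map `g`, and then pushing the
base point forward along `g`. -/
lemma map_prodMap_compProd_comap {A B C : Type*} [MeasurableSpace A] [MeasurableSpace B]
    [MeasurableSpace C] (P : Measure A) [SFinite P] (κ : Kernel B C)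
    [IsSFiniteKernel κ] {g : A → B} (hg : Measurable g) :
    (P ⊗ₘ κ.comap g hg).map (fun p => (g p.1, p.2)) = (P.map g) ⊗ₘ κ := by
  have hm : Measurable (fun p : A × C => (g p.1, p.2)) := by fun_prop
  ext s hs
  rw [Measure.map_apply hm hs, Measure.compProd_apply (hm hs), Measure.compProd_apply hs,
    lintegral_map (Kernel.measurable_kernel_prodMk_left hs) hg]
  rfl

/-- Gluing: a sequence of plans with matching marginals is realized, up to any finite time, by the
consecutive pairs of a random sequence. -/
lemma exists_glue {X : Type*} [MeasurableSpace X] [StandardBorelSpace X] [Nonempty X]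
    (π : ℕ → Measure (X × X)) (hπ : ∀ k, IsProbabilityMeasure (π k))
    (h : ∀ k, (π k).map Prod.snd = (π (k + 1)).map Prod.fst) (N : ℕ) :
    ∃ P : Measure (ℕ → X), IsProbabilityMeasure P ∧
      P.map (fun y => y N) = (π N).map Prod.fst ∧
      ∀ k < N, P.map (fun y => (y k, y (k + 1))) = π k := by
  induction N with
  | zero =>
    have hm : Measurable (fun (x : X × X) (_ : ℕ) => x.1) := by fun_prop
    refine ⟨(π 0).map (fun x _ => x.1), isProbabilityMeasure_map hm.aemeasurable, ?_, by simp⟩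
    rw [Measure.map_map (by fun_prop) hm]
    rfl
  | succ N ih =>
    obtain ⟨P, hP, hPN, hPk⟩ := ih
    have hev : Measurable (fun y : ℕ → X => y N) := by fun_prop
    set κ := (π N).condKernel.comap (fun y : ℕ → X => y N) hev with hκ
    have hu : Measurable (fun p : (ℕ → X) × X => Function.update p.1 (N + 1) p.2) := by
      rw [measurable_pi_iff]
      intro a
      by_cases ha : a = N + 1
      · subst ha
        simpa using measurable_snd
      · simp only [Function.update_of_ne ha]
        fun_prop
    have hpair : (P ⊗ₘ κ).map (fun p => (p.1 N, p.2)) = π N := by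
      rw [hκ, map_prodMap_compProd_comap P _ hev, hPN]
      exact (π N).disintegrate (π N).condKernel
    refine ⟨(P ⊗ₘ κ).map (fun p => Function.update p.1 (N + 1) p.2),
      isProbabilityMeasure_map hu.aemeasurable, ?_, fun k hk => ?_⟩
    · rw [Measure.map_map (by fun_prop) hu, ← h N]
      conv_rhs => rw [← hpair]
      rw [Measure.map_map (by fun_prop) (by fun_prop)]
      congr 1
      ext p
      simp
    · rw [Measure.map_map (by fun_prop) hu]
      rcases Nat.lt_succ_iff_lt_or_eq.1 hk with hk | rfl
      · rw [← hPk k hk]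
        conv_rhs => rw [← Measure.fst_compProd P κ]
        rw [Measure.fst, Measure.map_map (by fun_prop) (by fun_prop)]
        congr 1
        ext p <;> simp [Function.update_of_ne (show k ≠ N + 1 by omega),
          Function.update_of_ne (show k + 1 ≠ N + 1 by omega)]
      · conv_rhs => rw [← hpair]
        congr 1
        ext p <;> simp

end MeasureTheory.Measure

section Wasserstein

variable {X : Type*} [MetricSpace X] [MeasurableSpace X] [BorelSpace X]
  [SecondCountableTopology X]

lemma W2cost_lt_top (μ ν : W2Space X) : W2cost μ.1 ν.1 < ⊤ := by
  obtain ⟨μ, hμ, a, ha⟩ := μ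
  obtain ⟨ν, hν, b, hb⟩ := ν
  refine lt_of_le_of_lt (iInf₂_le (μ.prod ν) ⟨by simp, by simp⟩) ?_
  have key : ∀ p : X × X, ENNReal.ofReal (dist p.1 p.2) ^ 2 ≤
      3 * (ENNReal.ofReal (dist a p.1) ^ 2 + ENNReal.ofReal (dist a b) ^ 2 +
        ENNReal.ofReal (dist b p.2) ^ 2) := by
    intro p
    rw [show (3 : ℝ≥0∞) = ENNReal.ofReal 3 by simp, ← ENNReal.ofReal_pow dist_nonneg,
      ← ENNReal.ofReal_pow dist_nonneg, ← ENNReal.ofReal_pow dist_nonneg,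
      ← ENNReal.ofReal_pow dist_nonneg, ← ENNReal.ofReal_add (by positivity) (by positivity),
      ← ENNReal.ofReal_add (by positivity) (by positivity), ← ENNReal.ofReal_mul (by positivity)]
    apply ENNReal.ofReal_le_ofReal
    have h1 : dist p.1 p.2 ≤ dist a p.1 + dist a b + dist b p.2 := by
      rw [dist_comm a p.1]
      exact dist_triangle4 _ _ _ _
    have h2 := pow_le_pow_left₀ dist_nonneg h1 2
    nlinarith [sq_nonneg (dist a p.1 - dist a b), sq_nonneg (dist a p.1 - dist b p.2),
      sq_nonneg (dist a b - dist b p.2)]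
  refine (lintegral_mono key).trans_lt ?_
  rw [lintegral_const_mul _ (by fun_prop), lintegral_add_left (by fun_prop),
    lintegral_add_left (by fun_prop)]
  have e1 : ∫⁻ p : X × X, ENNReal.ofReal (dist a p.1) ^ 2 ∂(μ.prod ν) =
      ∫⁻ x, ENNReal.ofReal (dist a x) ^ 2 ∂μ := by
    have := lintegral_map (μ := μ.prod ν) (g := Prod.fst)
      (f := fun x => ENNReal.ofReal (dist a x) ^ 2) (by fun_prop) measurable_fst
    simpa using this.symm
  have e2 : ∫⁻ p : X × X, ENNReal.ofReal (dist b p.2) ^ 2 ∂(μ.prod ν) =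
      ∫⁻ x, ENNReal.ofReal (dist b x) ^ 2 ∂ν := by
    have := lintegral_map (μ := μ.prod ν) (g := Prod.snd)
      (f := fun x => ENNReal.ofReal (dist b x) ^ 2) (by fun_prop) measurable_snd
    simpa using this.symm
  rw [e1, e2, lintegral_const]
  simp only [measure_univ, mul_one]
  exact ENNReal.mul_lt_top (by simp) (ENNReal.add_lt_top.2
    ⟨ENNReal.add_lt_top.2 ⟨ha, by simp⟩, hb⟩)

lemma W2cost_eq_ofReal (μ ν : W2Space X) : W2cost μ.1 ν.1 = ENNReal.ofReal (Wdist μ ν ^ 2) := by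
  rw [Wdist, Real.sq_sqrt ENNReal.toReal_nonneg, ENNReal.ofReal_toReal (W2cost_lt_top μ ν).ne]

omit [BorelSpace X] [SecondCountableTopology X] in
lemma exists_coupling_of_W2cost_lt {μ ν : Measure X} {c : ℝ≥0∞} (h : W2cost μ ν < c) :
    ∃ π : Measure (X × X), IsCoupling π μ ν ∧
      ∫⁻ p, ENNReal.ofReal (dist p.1 p.2) ^ 2 ∂π < c := by
  simp only [W2cost, iInf_lt_iff] at h
  obtain ⟨π, hπ, h⟩ := h
  exact ⟨π, hπ, h⟩

/-- Integrals of Lipschitz functions are controlled by the transport cost. -/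
lemma lintegral_le_add_of_W2cost_lt {μ ν : Measure X} {f : X → ℝ≥0} {K : ℝ≥0}
    (hf : LipschitzWith K f) {ε : ℝ} (hε : 0 < ε)
    [IsProbabilityMeasure μ] (h : W2cost μ ν < ENNReal.ofReal (ε ^ 2)) :
    ∫⁻ x, f x ∂μ ≤ ∫⁻ x, f x ∂ν + ENNReal.ofReal (2 * K * ε) := by
  obtain ⟨π, ⟨h1, h2⟩, hc⟩ := exists_coupling_of_W2cost_lt h
  have hprob : IsProbabilityMeasure π := by
    have : IsProbabilityMeasure (π.map Prod.fst) := h1 ▸ inferInstance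
    exact Measure.isProbabilityMeasure_of_map Prod.fst
  have hfm : Measurable fun x => (f x : ℝ≥0∞) := by
    have := hf.continuous.measurable
    fun_prop
  have key : ∀ p : X × X, (f p.1 : ℝ≥0∞) ≤
      f p.2 + ENNReal.ofReal (K * ε) +
        ENNReal.ofReal (K / ε) * ENNReal.ofReal (dist p.1 p.2) ^ 2 := by
    intro p
    rw [← ENNReal.ofReal_coe_nnreal, ← ENNReal.ofReal_coe_nnreal,
      ← ENNReal.ofReal_pow dist_nonneg, ← ENNReal.ofReal_mul (by positivity),
      ← ENNReal.ofReal_add (by positivity) (by positivity),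
      ← ENNReal.ofReal_add (by positivity) (by positivity)]
    apply ENNReal.ofReal_le_ofReal
    have h3 := hf.dist_le_mul p.1 p.2
    rw [NNReal.dist_eq] at h3
    have h4 : dist p.1 p.2 ≤ ε + dist p.1 p.2 ^ 2 / ε := by
      rw [← sub_le_iff_le_add', le_div_iff₀ hε]
      nlinarith [sq_nonneg (dist p.1 p.2 - ε), sq_nonneg (dist p.1 p.2)]
    have h5 := mul_le_mul_of_nonneg_left h4 K.coe_nonneg
    have h6 : (K : ℝ) * (ε + dist p.1 p.2 ^ 2 / ε) = K * ε + K / ε * dist p.1 p.2 ^ 2 := by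
      ring
    linarith [le_abs_self ((f p.1 : ℝ) - f p.2)]
  rw [← h1, ← h2, lintegral_map hfm measurable_fst, lintegral_map hfm measurable_snd]
  refine (lintegral_mono key).trans ?_
  have hfm2 : Measurable fun p : X × X => (f p.2 : ℝ≥0∞) := hfm.comp measurable_snd
  rw [lintegral_add_left (hfm2.add_const _), lintegral_add_left hfm2, lintegral_const,
    lintegral_const_mul _ (by fun_prop), measure_univ, mul_one, add_assoc]
  gcongr
  calc _ ≤ ENNReal.ofReal (K * ε) + ENNReal.ofReal (K / ε) * ENNReal.ofReal (ε ^ 2) := by gcongr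
    _ = _ := by
      rw [← ENNReal.ofReal_mul (by positivity), ← ENNReal.ofReal_add (by positivity)
        (by positivity)]
      congr 1
      field_simp
      ring

end Wasserstein

section DiscreteInterpolation

variable {X : Type*} [MetricSpace X] [MeasurableSpace X] [BorelSpace X]
  [SecondCountableTopology X]

lemma lintegral_dist_sq_le_of_consecutive {P : Measure (ℕ → X)} {c : ℝ} {N : ℕ}
    (h : ∀ k ≤ N, ∫⁻ y, ENNReal.ofReal (dist (y k) (y (k + 1))) ^ 2 ∂P ≤ ENNReal.ofReal c)
    {j k : ℕ} (hjk : j ≤ k) (hk : k ≤ N) :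
    ∫⁻ y, ENNReal.ofReal (dist (y j) (y k)) ^ 2 ∂P ≤
      ENNReal.ofReal (((k : ℝ) - j) ^ 2 * c) := by
  have hcast : ((k - j : ℕ) : ℝ) = (k : ℝ) - j := Nat.cast_sub hjk
  have key : ∀ y : ℕ → X, ENNReal.ofReal (dist (y j) (y k)) ^ 2 ≤
      ((k - j : ℕ) : ℝ≥0∞) *
        ∑ i ∈ Finset.Ico j k, ENNReal.ofReal (dist (y i) (y (i + 1))) ^ 2 := by
    intro y
    simp_rw [← ENNReal.ofReal_pow dist_nonneg]
    rw [← ENNReal.ofReal_sum_of_nonneg (fun _ _ => by positivity), ← ENNReal.ofReal_natCast,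
      ← ENNReal.ofReal_mul (by positivity)]
    apply ENNReal.ofReal_le_ofReal
    refine (pow_le_pow_left₀ dist_nonneg (dist_le_Ico_sum_dist y hjk) 2).trans ?_
    simpa using sq_sum_le_card_mul_sum_sq (s := Finset.Ico j k)
      (f := fun i => dist (y i) (y (i + 1)))
  calc ∫⁻ y, ENNReal.ofReal (dist (y j) (y k)) ^ 2 ∂P
      ≤ ∫⁻ y, ((k - j : ℕ) : ℝ≥0∞) *
          ∑ i ∈ Finset.Ico j k, ENNReal.ofReal (dist (y i) (y (i + 1))) ^ 2 ∂P :=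
        lintegral_mono key
    _ = ((k - j : ℕ) : ℝ≥0∞) *
          ∑ i ∈ Finset.Ico j k, ∫⁻ y, ENNReal.ofReal (dist (y i) (y (i + 1))) ^ 2 ∂P := by
        rw [lintegral_const_mul _ (by fun_prop), lintegral_finsetSum _ (by fun_prop)]
    _ ≤ ((k - j : ℕ) : ℝ≥0∞) * ∑ i ∈ Finset.Ico j k, ENNReal.ofReal c := by
        gcongr with i hi
        exact h i ((Finset.mem_Ico.1 hi).2.le.trans hk)
    _ = ENNReal.ofReal (((k : ℝ) - j) ^ 2 * c) := by
        rw [Finset.sum_const, Nat.card_Ico, nsmul_eq_mul, ← mul_assoc, ← hcast,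
          ENNReal.ofReal_mul (by positivity), ENNReal.ofReal_pow (by positivity),
          ENNReal.ofReal_natCast, sq]

/-- Random curves, indexed by rational times, which interpolate a Wasserstein ray at the times
`k / M`, `k ≤ N`, and are almost geodesic in the mean. -/
lemma exists_discrete_interpolation [CompleteSpace X] {v : ℝ} {μt : ℝ≥0 → W2Space X}
    (hray : ∀ s t : ℝ≥0, Wdist (μt s) (μt t) = v * dist s t) {M : ℕ} (hM : 0 < M) (N : ℕ) :
    ∃ Q : Measure (ℚ≥0 → X), IsProbabilityMeasure Q ∧
      (∀ (q : ℚ≥0) (k : ℕ), k ≤ N → q * M = k → Q.map (fun x => x q) = (μt q).1) ∧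
      ∀ (q r : ℚ≥0) (j k : ℕ), j ≤ k → k ≤ N → q * M = j → r * M = k →
        ∫⁻ x, ENNReal.ofReal (dist (x q) (x r)) ^ 2 ∂Q ≤
          ENNReal.ofReal (((r : ℝ) - q) ^ 2 * (v ^ 2 + 1 / M)) := by
  have hM' : (0 : ℝ) < M := by exact_mod_cast hM
  set c : ℝ := v ^ 2 / M ^ 2 + 1 / M ^ 3 with hc
  set τ : ℕ → ℝ≥0 := fun k => k / M with hτ
  have hcost : ∀ k, W2cost (μt (τ k)).1 (μt (τ (k + 1))).1 < ENNReal.ofReal c := by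
    intro k
    rw [W2cost_eq_ofReal, hray]
    apply (ENNReal.ofReal_lt_ofReal_iff (by positivity)).2
    have hd : dist (τ k) (τ (k + 1)) = 1 / M := by
      rw [NNReal.dist_eq, hτ]
      push_cast
      rw [show (k : ℝ) / M - (k + 1) / M = -(1 / M) by ring, abs_neg, abs_of_pos (by positivity)]
    rw [hd, hc]
    have : (0 : ℝ) < 1 / M ^ 3 := by positivity
    calc (v * (1 / M)) ^ 2 = v ^ 2 / M ^ 2 := by ring
      _ < _ := by linarith
  choose π hπ hπc using fun k => exists_coupling_of_W2cost_lt (hcost k)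
  have hπprob : ∀ k, IsProbabilityMeasure (π k) := fun k => by
    have : IsProbabilityMeasure ((π k).map Prod.fst) := (hπ k).1 ▸ (μt (τ k)).2.1
    exact Measure.isProbabilityMeasure_of_map Prod.fst
  have : Nonempty X := by
    have := (μt 0).2.1
    exact nonempty_of_isProbabilityMeasure (μt 0).1
  have : PolishSpace X := {}
  obtain ⟨P, hP, -, hPk⟩ := Measure.exists_glue π hπprob
    (fun k => (hπ k).2.trans (hπ (k + 1)).1.symm) (N + 1)
  have hone : ∀ k ≤ N, P.map (fun y => y k) = (μt (τ k)).1 := by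
    intro k hk
    rw [← (hπ k).1, ← hPk k (by omega), Measure.map_map (by fun_prop) (by fun_prop)]
    rfl
  have hstep : ∀ k ≤ N,
      ∫⁻ y, ENNReal.ofReal (dist (y k) (y (k + 1))) ^ 2 ∂P ≤ ENNReal.ofReal c := by
    intro k hk
    refine le_trans (le_of_eq ?_) (hπc k).le
    rw [← hPk k (by omega), lintegral_map (by fun_prop) (by fun_prop)]
  have hm : Measurable (fun (y : ℕ → X) (q : ℚ≥0) => y ⌊q * M⌋₊) := by fun_prop
  have hMq : (M : ℚ≥0) ≠ 0 := by exact_mod_cast hM.ne'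
  have hq : ∀ (q : ℚ≥0) (k : ℕ), q * M = k → q = k / M := fun q k h => by
    rw [← h, mul_div_assoc, div_self hMq, mul_one]
  refine ⟨P.map (fun y q => y ⌊q * M⌋₊), Measure.isProbabilityMeasure_map hm.aemeasurable, ?_, ?_⟩
  · intro q k hk hqk
    rw [Measure.map_map (by fun_prop) hm]
    have e : (fun x : ℚ≥0 → X => x q) ∘ (fun (y : ℕ → X) (q : ℚ≥0) => y ⌊q * M⌋₊) =
        fun y => y k := by
      ext y
      simp [hqk]
    rw [e, hone k hk, hq q k hqk]
    simp [hτ]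
  · intro q r j k hjk hk hqj hrk
    rw [lintegral_map (by fun_prop) hm]
    simp only [hqj, hrk, Nat.floor_natCast]
    refine (lintegral_dist_sq_le_of_consecutive hstep hjk hk).trans (le_of_eq ?_)
    rw [hq q j hqj, hq r k hrk, hc]
    congr 1
    push_cast
    field_simp

omit [MetricSpace X] [MeasurableSpace X] [BorelSpace X] [SecondCountableTopology X] in
lemma NNRat.eventually_mul_factorial_eq_natCast (q : ℚ≥0) :
    ∀ᶠ n : ℕ in atTop, ∃ k : ℕ, k ≤ n * n.factorial ∧ q * (n.factorial : ℚ≥0) = k := by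
  filter_upwards [eventually_ge_atTop q.den, eventually_ge_atTop ⌈q⌉₊] with n h1 h2
  obtain ⟨m, hm⟩ := Nat.dvd_factorial q.den_pos h1
  have hk : q * (n.factorial : ℚ≥0) = (q.num * m : ℕ) := by
    rw [hm]
    push_cast
    rw [← mul_assoc, NNRat.mul_den_eq_num]
  refine ⟨_, ?_, hk⟩
  have hqn : q ≤ n := (Nat.le_ceil q).trans (by exact_mod_cast h2)
  have : ((q.num * m : ℕ) : ℚ≥0) ≤ ((n * n.factorial : ℕ) : ℚ≥0) := by
    rw [← hk]
    push_cast
    gcongr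
  exact_mod_cast this

/-- A finite set of finite measures on a Polish space is tight. -/
lemma isTightMeasureSet_of_finite [CompleteSpace X] {S : Set (Measure X)} (hS : S.Finite)
    (h : ∀ μ ∈ S, IsFiniteMeasure μ) : IsTightMeasureSet S := by
  induction S, hS using Set.Finite.induction_on with
  | empty =>
    rw [isTightMeasureSet_iff_exists_isCompact_measure_compl_le]
    exact fun _ _ => ⟨∅, isCompact_empty, by simp⟩
  | @insert μ S _ _ ih =>
    have := h μ (Set.mem_insert _ _)
    rw [Set.insert_eq]
    exact isTightMeasureSet_singleton.union (ih fun ν hν => h ν (Set.mem_insert_of_mem _ hν))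

/-- A sequence of laws of random curves indexed by a countable set is tight as soon as each of
its marginals is eventually constant. -/
lemma isTightMeasureSet_range_of_eventually_map_eq [CompleteSpace X] {ι : Type*} [Countable ι]
    (Q : ℕ → Measure (ι → X)) (hQ : ∀ n, IsProbabilityMeasure (Q n)) (μ : ι → Measure X)
    (h : ∀ i, ∀ᶠ n in atTop, (Q n).map (fun x => x i) = μ i) :
    IsTightMeasureSet (Set.range Q) := by
  have hfin : ∀ i, (Set.range fun n => (Q n).map (fun x => x i)).Finite := by
    intro i
    obtain ⟨n₀, hn₀⟩ := eventually_atTop.1 (h i)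
    refine (((Set.finite_lt_nat n₀).image fun n => (Q n).map (fun x => x i)).union
      (Set.finite_singleton (μ i))).subset ?_
    rintro _ ⟨n, rfl⟩
    rcases lt_or_ge n n₀ with hn | hn
    · exact Or.inl ⟨n, hn, rfl⟩
    · exact Or.inr (hn₀ n hn)
  have htight : ∀ i, IsTightMeasureSet (Set.range fun n => (Q n).map (fun x => x i)) := by
    intro i
    refine isTightMeasureSet_of_finite (hfin i) ?_
    rintro _ ⟨n, rfl⟩
    infer_instance
  simp only [isTightMeasureSet_iff_exists_isCompact_measure_compl_le, Set.forall_mem_range]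
    at htight ⊢
  intro ε hε
  obtain ⟨δ, hδ, hsum⟩ := ENNReal.exists_pos_tsum_mul_lt_of_countable hε.ne' (fun _ : ι => 1)
    (by simp)
  choose K hK hKμ using fun i => htight i (δ i) (by exact_mod_cast hδ i)
  refine ⟨Set.univ.pi K, isCompact_univ_pi hK, fun n => ?_⟩
  have hsub : (Set.univ.pi K)ᶜ ⊆ ⋃ i, (fun x : ι → X => x i) ⁻¹' (K i)ᶜ := by
    intro x hx
    simpa [Set.mem_pi] using hx
  refine (measure_mono hsub).trans ((measure_iUnion_le _).trans ?_)
  refine le_trans (ENNReal.tsum_le_tsum fun i => ?_) hsum.le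
  have := hKμ i n
  rw [Measure.map_apply (by fun_prop) (hK i).measurableSet.compl] at this
  simpa using this

/-- Random curves, indexed by rational times, which interpolate a Wasserstein ray at all rational
times and whose mean squared displacements are at most those of the ray. -/
lemma exists_rational_interpolation [CompleteSpace X] {v : ℝ} {μt : ℝ≥0 → W2Space X}
    (hray : ∀ s t : ℝ≥0, Wdist (μt s) (μt t) = v * dist s t) :
    ∃ P : Measure (ℚ≥0 → X), IsProbabilityMeasure P ∧
      (∀ q : ℚ≥0, P.map (fun x => x q) = (μt q).1) ∧
      ∀ q r : ℚ≥0, q ≤ r →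
        ∫⁻ x, ENNReal.ofReal (dist (x q) (x r)) ^ 2 ∂P ≤
          ENNReal.ofReal ((v * ((r : ℝ) - q)) ^ 2) := by
  choose Q hQ hQ1 hQ2 using fun n : ℕ =>
    exists_discrete_interpolation hray (Nat.factorial_pos n) (n * n.factorial)
  have hmarg : ∀ q : ℚ≥0, ∀ᶠ n in atTop, (Q n).map (fun x => x q) = (μt q).1 := by
    intro q
    filter_upwards [q.eventually_mul_factorial_eq_natCast] with n ⟨k, hk, hqk⟩
    exact hQ1 n q k hk hqk
  have htight := isTightMeasureSet_range_of_eventually_map_eq Q hQ _ hmarg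
  let Q' : ℕ → ProbabilityMeasure (ℚ≥0 → X) := fun n => ⟨Q n, hQ n⟩
  have hcomp : IsCompact (closure (Set.range Q')) := by
    apply isCompact_closure_of_isTightMeasureSet
    refine htight.subset ?_
    rintro _ ⟨_, ⟨n, rfl⟩, rfl⟩
    exact ⟨n, rfl⟩
  obtain ⟨P, -, hP⟩ := hcomp.ultrafilter_le_nhds' ((hyperfilter ℕ).map Q')
    (Filter.mem_of_superset (Ultrafilter.mem_map.2
      (by rw [Set.preimage_range]; exact Filter.univ_mem)) subset_closure)
  have hlim : Tendsto Q' (hyperfilter ℕ : Filter ℕ) (𝓝 P) := hP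
  have hat : (hyperfilter ℕ : Filter ℕ) ≤ atTop := Nat.hyperfilter_le_atTop
  refine ⟨P, inferInstance, fun q => ?_, fun q r hqr => ?_⟩
  · have hc : Continuous (fun x : ℚ≥0 → X => x q) := by fun_prop
    have h1 := ProbabilityMeasure.tendsto_map_of_tendsto_of_continuous Q' P hlim hc
    let μq : ProbabilityMeasure X := ⟨(μt q).1, (μt q).2.1⟩
    have h2 : Tendsto (fun n => (Q' n).map hc.measurable.aemeasurable) (hyperfilter ℕ : Filter ℕ)
        (𝓝 μq) := by
      refine tendsto_const_nhds.congr' ?_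
      filter_upwards [(hmarg q).filter_mono hat] with n hn
      exact Subtype.ext hn.symm
    have h3 := tendsto_nhds_unique h1 h2
    exact congrArg Subtype.val h3
  · have htrunc : ∀ m : ℕ, ∫⁻ x, min (ENNReal.ofReal (dist (x q) (x r)) ^ 2) m
        ∂(P : Measure (ℚ≥0 → X)) ≤
        ENNReal.ofReal ((v * ((r : ℝ) - q)) ^ 2) := by
      intro m
      let f : BoundedContinuousFunction (ℚ≥0 → X) ℝ≥0 := BoundedContinuousFunction.mkOfBound
        ⟨fun x => min (nndist (x q) (x r) ^ 2) m, by fun_prop⟩ m (fun x y => by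
          rw [NNReal.dist_eq, abs_le]
          have h1 : ((min (nndist (x q) (x r) ^ 2) m : ℝ≥0) : ℝ) ≤ m := by
            exact_mod_cast min_le_right _ _
          have h2 : ((min (nndist (y q) (y r) ^ 2) m : ℝ≥0) : ℝ) ≤ m := by
            exact_mod_cast min_le_right _ _
          have h3 := (min (nndist (x q) (x r) ^ 2) (m : ℝ≥0)).coe_nonneg
          have h4 := (min (nndist (y q) (y r) ^ 2) (m : ℝ≥0)).coe_nonneg
          exact ⟨by simp only [ContinuousMap.coe_mk]; linarith,
            by simp only [ContinuousMap.coe_mk]; linarith⟩)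
      have hf : ∀ x, (f x : ℝ≥0∞) = min (ENNReal.ofReal (dist (x q) (x r)) ^ 2) m := by
        intro x
        rw [← edist_dist, edist_nndist]
        simp [f]
      have h1 := ProbabilityMeasure.tendsto_iff_forall_lintegral_tendsto.1 hlim f
      have h2 : Tendsto (fun n : ℕ => ENNReal.ofReal
          (((r : ℝ) - q) ^ 2 * (v ^ 2 + 1 / (n.factorial : ℝ)))) (hyperfilter ℕ : Filter ℕ)
          (𝓝 (ENNReal.ofReal ((v * ((r : ℝ) - q)) ^ 2))) := by
        apply ENNReal.tendsto_ofReal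
        have h3 : Tendsto (fun n : ℕ => 1 / (n.factorial : ℝ)) atTop (𝓝 0) :=
          (tendsto_const_nhds (x := (1 : ℝ))).div_atTop
            (tendsto_natCast_atTop_atTop.comp (tendsto_atTop_mono Nat.self_le_factorial tendsto_id))
        have h4 := ((h3.mono_left hat).const_add (v ^ 2)).const_mul (((r : ℝ) - q) ^ 2)
        convert h4 using 2
        ring
      simp_rw [← hf]
      refine le_of_tendsto_of_tendsto h1 h2 ?_
      filter_upwards [(q.eventually_mul_factorial_eq_natCast).filter_mono hat,
        (r.eventually_mul_factorial_eq_natCast).filter_mono hat] with n ⟨j, _, hj⟩ ⟨k, hk, hkr⟩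
      have hjk : j ≤ k := by
        have : (j : ℚ≥0) ≤ k := by
          rw [← hj, ← hkr]
          gcongr
        exact_mod_cast this
      refine le_trans (lintegral_mono fun x => ?_) (hQ2 n q r j k hjk hk hj hkr)
      rw [hf]
      exact min_le_left _ _
    have hsup : ∀ x : ℚ≥0 → X, ENNReal.ofReal (dist (x q) (x r)) ^ 2 =
        ⨆ m : ℕ, min (ENNReal.ofReal (dist (x q) (x r)) ^ 2) m := by
      intro x
      rw [← inf_iSup_eq, ENNReal.iSup_natCast, inf_top_eq]
    rw [lintegral_congr hsup, lintegral_iSup (fun m => by fun_prop) (fun m n hmn x => by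
      dsimp only
      gcongr)]
    exact iSup_le htrunc

end DiscreteInterpolation

section GeodesicInterpolation

lemma dist_eq_mul_abs_of_proportional {X : Type*} [MetricSpace X] {x : ℚ≥0 → X}
    (h : ∀ q r s : ℚ≥0, q < r → r < s →
      dist (x r) (x s) * ((r : ℝ) - q) = dist (x q) (x r) * ((s : ℝ) - r) ∧
      dist (x q) (x s) * ((r : ℝ) - q) = dist (x q) (x r) * ((s : ℝ) - q)) (q r : ℚ≥0) :
    dist (x q) (x r) = dist (x 0) (x 1) * |(q : ℝ) - r| := by
  have h0 : ∀ t : ℚ≥0, dist (x 0) (x t) = dist (x 0) (x 1) * t := by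
    intro t
    rcases eq_or_ne t 0 with rfl | ht
    · simp
    rcases lt_trichotomy t 1 with ht1 | rfl | ht1
    · simpa using (h 0 t 1 (pos_iff_ne_zero.2 ht) ht1).2.symm
    · simp
    · simpa using (h 0 1 t one_pos ht1).2
  wlog hqr : q < r generalizing q r
  · rcases (not_lt.1 hqr).eq_or_lt with rfl | hlt
    · simp
    · rw [dist_comm, abs_sub_comm]
      exact this r q hlt
  have hqr' : (q : ℝ) < r := by exact_mod_cast hqr
  rw [abs_sub_comm, abs_of_pos (sub_pos.2 hqr')]
  rcases eq_or_ne q 0 with rfl | hq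
  · simpa using h0 r
  · have h1 := (h 0 q r (pos_iff_ne_zero.2 hq) hqr).1
    rw [h0 q] at h1
    have hq' : (q : ℝ) ≠ 0 := by exact_mod_cast hq
    apply mul_right_cancel₀ hq'
    push_cast at h1
    linear_combination h1

variable {X : Type*} [MetricSpace X] [MeasurableSpace X] [BorelSpace X]
  [SecondCountableTopology X]

omit [BorelSpace X] [SecondCountableTopology X] in
/-- Equality case of Minkowski's inequality for three consecutive times. -/
lemma ae_proportional_of_integral_dist_sq {P : Measure (ℚ≥0 → X)} {v : ℝ}
    (hint : ∀ q r : ℚ≥0, q < r → Integrable (fun x => dist (x q) (x r) ^ 2) P ∧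
      ∫ x, dist (x q) (x r) ^ 2 ∂P = (v * ((r : ℝ) - q)) ^ 2)
    {q r s : ℚ≥0} (hqr : q < r) (hrs : r < s) :
    ∀ᵐ x ∂P, dist (x r) (x s) * ((r : ℝ) - q) = dist (x q) (x r) * ((s : ℝ) - r) ∧
      dist (x q) (x s) * ((r : ℝ) - q) = dist (x q) (x r) * ((s : ℝ) - q) := by
  obtain ⟨i1, e1⟩ := hint q r hqr
  obtain ⟨i2, e2⟩ := hint r s hrs
  obtain ⟨i3, e3⟩ := hint q s (hqr.trans hrs)
  have ha : 0 < (r : ℝ) - q := sub_pos.2 (by exact_mod_cast hqr)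
  have hb : 0 < (s : ℝ) - r := sub_pos.2 (by exact_mod_cast hrs)
  have hs : (s : ℝ) - q = ((r : ℝ) - q) + ((s : ℝ) - r) := by ring
  rw [hs] at e3 ⊢
  generalize (r : ℝ) - q = a at *
  generalize (s : ℝ) - r = b at *
  let g : (ℚ≥0 → X) → ℝ := fun x =>
    (a + b) / a * dist (x q) (x r) ^ 2 + (a + b) / b * dist (x r) (x s) ^ 2
      - dist (x q) (x s) ^ 2
  have hi : Integrable (fun x => (a + b) / a * dist (x q) (x r) ^ 2 +
      (a + b) / b * dist (x r) (x s) ^ 2) P := (i1.const_mul _).add (i2.const_mul _)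
  have hgi : Integrable g P := hi.sub i3
  have hg0 : ∫ x, g x ∂P = 0 := by
    simp only [g]
    rw [integral_sub hi i3,
      integral_add (i1.const_mul _) (i2.const_mul _), integral_const_mul, integral_const_mul,
      e1, e2, e3]
    field_simp
    ring
  have hg : ∀ x, g x = (dist (x r) (x s) * a - dist (x q) (x r) * b) ^ 2 / (a * b) +
      ((dist (x q) (x r) + dist (x r) (x s)) ^ 2 - dist (x q) (x s) ^ 2) := by
    intro x
    simp only [g]
    field_simp
    ring
  have htri : ∀ x : ℚ≥0 → X,
      0 ≤ (dist (x q) (x r) + dist (x r) (x s)) ^ 2 - dist (x q) (x s) ^ 2 := fun x =>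
    sub_nonneg.2 (pow_le_pow_left₀ dist_nonneg (dist_triangle _ _ _) 2)
  have hsq : ∀ x : ℚ≥0 → X,
      0 ≤ (dist (x r) (x s) * a - dist (x q) (x r) * b) ^ 2 / (a * b) := fun x => by positivity
  have hae := (integral_eq_zero_iff_of_nonneg
    (fun x => by rw [hg]; exact add_nonneg (hsq x) (htri x)) hgi).1 hg0
  filter_upwards [hae] with x hx
  rw [Pi.zero_apply, hg] at hx
  have h1 : (dist (x r) (x s) * a - dist (x q) (x r) * b) ^ 2 / (a * b) = 0 := by
    linarith [hsq x, htri x]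
  have h2 : dist (x r) (x s) * a = dist (x q) (x r) * b := by
    rcases div_eq_zero_iff.1 h1 with h | h
    · exact sub_eq_zero.1 (pow_eq_zero_iff two_ne_zero |>.1 h)
    · exact absurd h (by positivity)
  have h3 : dist (x q) (x s) = dist (x q) (x r) + dist (x r) (x s) := by
    have : dist (x q) (x s) ^ 2 = (dist (x q) (x r) + dist (x r) (x s)) ^ 2 := by linarith
    exact (pow_left_inj₀ dist_nonneg (by positivity) two_ne_zero).1 this
  refine ⟨h2, ?_⟩
  rw [h3]
  linear_combination h2

/-- A Wasserstein ray is interpolated, at rational times, by a random geodesic. -/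
lemma exists_rational_geodesic_interpolation [CompleteSpace X] {v : ℝ} {μt : ℝ≥0 → W2Space X}
    (hray : ∀ s t : ℝ≥0, Wdist (μt s) (μt t) = v * dist s t) :
    ∃ P : Measure (ℚ≥0 → X), IsProbabilityMeasure P ∧
      (∀ q : ℚ≥0, P.map (fun x => x q) = (μt q).1) ∧
      ∀ᵐ x ∂P, ∀ q r : ℚ≥0, dist (x q) (x r) = dist (x 0) (x 1) * |(q : ℝ) - r| := by
  obtain ⟨P, hP, hmarg, hle⟩ := exists_rational_interpolation hray
  refine ⟨P, hP, hmarg, ?_⟩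
  have heq : ∀ q r : ℚ≥0, q < r → ∫⁻ x, ENNReal.ofReal (dist (x q) (x r) ^ 2) ∂P =
      ENNReal.ofReal ((v * ((r : ℝ) - q)) ^ 2) := by
    intro q r hqr
    simp_rw [ENNReal.ofReal_pow dist_nonneg]
    refine le_antisymm (hle q r hqr.le) ?_
    have hd : (v * ((r : ℝ) - q)) ^ 2 = Wdist (μt q) (μt r) ^ 2 := by
      have hcast : ∀ t : ℚ≥0, (((t : ℝ≥0) : ℝ)) = t := fun _ => rfl
      rw [hray, NNReal.dist_eq, mul_pow, mul_pow, sq_abs, hcast, hcast]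
      ring
    rw [hd, ← W2cost_eq_ofReal]
    refine (iInf₂_le (P.map fun x => (x q, x r)) ⟨?_, ?_⟩).trans (le_of_eq ?_)
    · rw [lintegral_map (by fun_prop) (by fun_prop)]
    · rw [Measure.map_map (by fun_prop) (by fun_prop), ← hmarg q]
      rfl
    · rw [Measure.map_map (by fun_prop) (by fun_prop), ← hmarg r]
      rfl
  have hint : ∀ q r : ℚ≥0, q < r → Integrable (fun x => dist (x q) (x r) ^ 2) P ∧
      ∫ x, dist (x q) (x r) ^ 2 ∂P = (v * ((r : ℝ) - q)) ^ 2 := by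
    intro q r hqr
    have hm : Measurable fun x : ℚ≥0 → X => dist (x q) (x r) ^ 2 := by fun_prop
    refine ⟨⟨hm.aestronglyMeasurable, ?_⟩, ?_⟩
    · rw [hasFiniteIntegral_iff_ofReal (Eventually.of_forall fun x => by positivity), heq q r hqr]
      exact ENNReal.ofReal_lt_top
    · rw [integral_eq_lintegral_of_nonneg_ae (Eventually.of_forall fun x => by positivity)
        hm.aestronglyMeasurable, heq q r hqr, ENNReal.toReal_ofReal (by positivity)]
  have hae : ∀ᵐ x ∂P, ∀ q r s : ℚ≥0, q < r → r < s →
      dist (x r) (x s) * ((r : ℝ) - q) = dist (x q) (x r) * ((s : ℝ) - r) ∧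
      dist (x q) (x s) * ((r : ℝ) - q) = dist (x q) (x r) * ((s : ℝ) - q) := by
    simp_rw [ae_all_iff]
    exact fun q r s hqr hrs => ae_proportional_of_integral_dist_sq hint hqr hrs
  filter_upwards [hae] with x hx
  exact dist_eq_mul_abs_of_proportional hx

lemma exists_seq_nnrat_tendsto (t : ℝ≥0) :
    ∃ u : ℕ → ℚ≥0, Tendsto (fun n => (u n : ℝ)) atTop (𝓝 t) := by
  refine ⟨fun n => (⌊(t : ℝ) * n⌋₊ : ℚ≥0) / n, ?_⟩
  simpa [Function.comp_def] using (tendsto_nat_floor_mul_div_atTop t.coe_nonneg).comp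
    (tendsto_natCast_atTop_atTop (R := ℝ))

/-- A rational geodesic in a complete space extends continuously to a geodesic ray. -/
lemma exists_ray_of_rational_geodesic {X : Type*} [MetricSpace X] [CompleteSpace X]
    {x : ℚ≥0 → X} (hx : ∀ q r : ℚ≥0, dist (x q) (x r) = dist (x 0) (x 1) * |(q : ℝ) - r|) :
    ∃ γ : RaySpace X, ∀ (t : ℝ≥0) (u : ℕ → ℚ≥0),
      Tendsto (fun n => (u n : ℝ)) atTop (𝓝 t) →
        Tendsto (fun n => x (u n)) atTop (𝓝 (γ.1 t)) := by
  choose u hu using exists_seq_nnrat_tendsto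
  have hdist : ∀ {a b : ℕ → ℚ≥0} {s t : ℝ≥0}, Tendsto (fun n => (a n : ℝ)) atTop (𝓝 s) →
      Tendsto (fun n => (b n : ℝ)) atTop (𝓝 t) →
      Tendsto (fun n => dist (x (a n)) (x (b n))) atTop
        (𝓝 (dist (x 0) (x 1) * dist s t)) := fun ha hb => by
    rw [NNReal.dist_eq]
    exact (((ha.sub hb).abs).const_mul _).congr fun n => (hx _ _).symm
  have hcauchy : ∀ t, CauchySeq fun n => x (u t n) := by
    intro t
    have h : CauchySeq fun n => dist (x 0) (x 1) * (u t n : ℝ) :=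
      ((hu t).const_mul _).cauchySeq
    rw [Metric.cauchySeq_iff] at h ⊢
    intro ε hε
    obtain ⟨N, hN⟩ := h ε hε
    refine ⟨N, fun m hm n hn => ?_⟩
    have := hN m hm n hn
    rwa [Real.dist_eq, ← mul_sub, abs_mul, abs_of_nonneg dist_nonneg, ← hx] at this
  choose γ hγ using fun t => cauchySeq_tendsto_of_complete (hcauchy t)
  refine ⟨⟨γ, dist (x 0) (x 1), dist_nonneg, fun s t => ?_⟩, fun t w hw => ?_⟩
  · exact tendsto_nhds_unique ((hγ s).dist (hγ t)) (hdist (hu s) (hu t))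
  · refine (hγ t).congr_dist ?_
    simpa using hdist (hu t) hw

/-- The extension of rational geodesics to geodesic rays can be made measurably. -/
lemma exists_measurable_extension [CompleteSpace X] [Nonempty X] :
    ∃ F : (ℚ≥0 → X) → RaySpace X, Measurable F ∧ ∀ x : ℚ≥0 → X,
      (∀ q r : ℚ≥0, dist (x q) (x r) = dist (x 0) (x 1) * |(q : ℝ) - r|) →
      ∀ (t : ℝ≥0) (u : ℕ → ℚ≥0), Tendsto (fun n => (u n : ℝ)) atTop (𝓝 t) →
        Tendsto (fun n => x (u n)) atTop (𝓝 ((F x).1 t)) := by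
  classical
  set G : Set (ℚ≥0 → X) :=
    {x | ∀ q r : ℚ≥0, dist (x q) (x r) = dist (x 0) (x 1) * |(q : ℝ) - r|} with hG
  have hGm : MeasurableSet G := by
    rw [hG]
    simp only [Set.ofPred_forall]
    exact MeasurableSet.iInter fun q => MeasurableSet.iInter fun r =>
      measurableSet_eq_fun (by fun_prop) (by fun_prop)
  obtain ⟨x₀⟩ := ‹Nonempty X›
  let γ₀ : RaySpace X := ⟨fun _ => x₀, 0, le_rfl, fun _ _ => by simp⟩
  have hex : ∀ x : ℚ≥0 → X, ∃ γ : RaySpace X, (x ∉ G → γ = γ₀) ∧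
      (x ∈ G → ∀ (t : ℝ≥0) (u : ℕ → ℚ≥0), Tendsto (fun n => (u n : ℝ)) atTop (𝓝 t) →
        Tendsto (fun n => x (u n)) atTop (𝓝 (γ.1 t))) := by
    intro x
    by_cases hx : x ∈ G
    · obtain ⟨γ, hγ⟩ := exists_ray_of_rational_geodesic hx
      exact ⟨γ, fun h => absurd hx h, fun _ => hγ⟩
    · exact ⟨γ₀, fun _ => rfl, fun h => absurd h hx⟩
  choose F hF₀ hF using hex
  refine ⟨F, ?_, fun x hx => hF x hx⟩
  refine Measurable.subtype_mk (f := fun x => (F x).1) (measurable_pi_iff.2 fun t => ?_)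
  obtain ⟨u, hu⟩ := exists_seq_nnrat_tendsto t
  refine measurable_of_tendsto_metrizable
    (f := fun n (x : ℚ≥0 → X) => if x ∈ G then x (u n) else x₀)
    (fun n => Measurable.ite hGm (by fun_prop) measurable_const)
    (tendsto_pi_nhds.2 fun x => ?_)
  by_cases hx : x ∈ G
  · simp only [if_pos hx]
    exact hF x hx t u hu
  · simp only [if_neg hx, hF₀ x hx]
    exact tendsto_const_nhds

end GeodesicInterpolation

section Marginals

variable {X : Type*} [MetricSpace X] [MeasurableSpace X] [BorelSpace X]

/-- Probability measures which give the same integral to bounded Lipschitz functions are equal. -/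
lemma ext_of_lintegral_lipschitz {μ ν : Measure X} [IsProbabilityMeasure μ]
    [IsProbabilityMeasure ν]
    (h : ∀ (f : BoundedContinuousFunction X ℝ≥0) (K : ℝ≥0), LipschitzWith K f →
      ∫⁻ x, f x ∂μ = ∫⁻ x, f x ∂ν) : μ = ν := by
  refine ext_of_generate_finite _ (BorelSpace.measurable_eq.trans borel_eq_generateFrom_isClosed)
    isPiSystem_isClosed (fun s hs => ?_) (by simp)
  obtain ⟨δ, -, hδ, hδ0⟩ := exists_seq_strictAnti_tendsto (0 : ℝ)
  have h1 := tendsto_lintegral_thickenedIndicator_of_isClosed μ hs hδ hδ0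
  have h2 := tendsto_lintegral_thickenedIndicator_of_isClosed ν hs hδ hδ0
  refine tendsto_nhds_unique h1 (h2.congr fun n => ?_)
  exact (h _ _ (lipschitzWith_thickenedIndicator (hδ n) s)).symm

/-- The law of an almost sure limit of random points whose laws converge in the Wasserstein
space is the limit law. -/
lemma map_eq_of_tendsto_of_W2cost [SecondCountableTopology X] {Ω : Type*} [MeasurableSpace Ω]
    {P : Measure Ω} [IsProbabilityMeasure P] {Y : ℕ → Ω → X} {Z : Ω → X}
    (hY : ∀ n, Measurable (Y n)) (hZ : Measurable Z)
    (hYZ : ∀ᵐ ω ∂P, Tendsto (fun n => Y n ω) atTop (𝓝 (Z ω)))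
    {ν : Measure X} [IsProbabilityMeasure ν]
    (h1 : Tendsto (fun n => W2cost (P.map (Y n)) ν) atTop (𝓝 0))
    (h2 : Tendsto (fun n => W2cost ν (P.map (Y n))) atTop (𝓝 0)) :
    P.map Z = ν := by
  have := Measure.isProbabilityMeasure_map (μ := P) hZ.aemeasurable
  have := fun n => Measure.isProbabilityMeasure_map (μ := P) (hY n).aemeasurable
  refine ext_of_lintegral_lipschitz fun f K hf => ?_
  have hfm : Measurable fun x => (f x : ℝ≥0∞) := by
    have := f.continuous.measurable
    fun_prop
  have hlim : Tendsto (fun n => ∫⁻ x, f x ∂P.map (Y n)) atTop (𝓝 (∫⁻ x, f x ∂P.map Z)) := by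
    simp_rw [lintegral_map hfm hZ, lintegral_map hfm (hY _)]
    refine tendsto_lintegral_of_dominated_convergence' (fun _ => (nndist f 0 : ℝ≥0∞))
      (fun n => (hfm.comp (hY n)).aemeasurable)
      (fun n => Eventually.of_forall fun ω => ?_) (by simp) ?_
    · exact ENNReal.coe_le_coe.2 (BoundedContinuousFunction.NNReal.upper_bound f _)
    · filter_upwards [hYZ] with ω hω
      exact ENNReal.tendsto_coe.2 ((f.continuous.tendsto _).comp hω)
  have hε : Tendsto (fun ε : ℝ => ENNReal.ofReal (2 * K * ε)) (𝓝[>] 0) (𝓝 0) := by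
    have : Tendsto (fun ε : ℝ => ENNReal.ofReal (2 * K * ε)) (𝓝 0)
        (𝓝 (ENNReal.ofReal (2 * K * 0))) := 
          (ENNReal.continuous_ofReal.comp (by fun_prop)).tendsto 0
    simpa using this.mono_left nhdsWithin_le_nhds
  have hpos : ∀ ε : ℝ, 0 < ε → 0 < ENNReal.ofReal (ε ^ 2) := fun ε hε =>
    ENNReal.ofReal_pos.2 (by positivity)
  apply le_antisymm
  · have := hε.const_add (∫⁻ x, f x ∂ν)
    rw [add_zero] at this
    refine ge_of_tendsto this (eventually_mem_nhdsWithin.mono fun ε h0 => ?_)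
    refine le_of_tendsto hlim ((h1.eventually_lt_const (hpos ε h0)).mono fun n hn => ?_)
    exact lintegral_le_add_of_W2cost_lt hf h0 hn
  · have := hε.const_add (∫⁻ x, f x ∂P.map Z)
    rw [add_zero] at this
    refine ge_of_tendsto this (eventually_mem_nhdsWithin.mono fun ε h0 => ?_)
    refine ge_of_tendsto (hlim.add_const _)
      ((h2.eventually_lt_const (hpos ε h0)).mono fun n hn => ?_)
    exact lintegral_le_add_of_W2cost_lt hf h0 hn

end Marginals

/-- **Statement 5.** Displacement interpolation for rays: every geodesic ray of `W₂(X)`,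
`X` Hadamard, is induced by a probability measure on the space of geodesic rays of `X`. -/
theorem displacement_interpolation_of_ray
    (X : Type*) [MetricSpace X] [MeasurableSpace X] [BorelSpace X] (hX : IsHadamard X)
    (v : ℝ) (hv : 0 ≤ v) (μt : ℝ≥0 → W2Space X)
    (hray : ∀ s t : ℝ≥0, Wdist (μt s) (μt t) = v * dist s t) :
    ∃ μ : Measure (RaySpace X), IsProbabilityMeasure μ ∧
      ∀ t : ℝ≥0, μ.map (rayEval t) = (μt t).1 := by
  have := hX.complete
  have := hX.separable
  have : SecondCountableTopology X := UniformSpace.secondCountable_of_separable X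
  have hprob : ∀ t, IsProbabilityMeasure (μt t).1 := fun t => (μt t).2.1
  have : Nonempty X := nonempty_of_isProbabilityMeasure (μt 0).1
  obtain ⟨P, hP, hmarg, hgeo⟩ := exists_rational_geodesic_interpolation hray
  obtain ⟨F, hF, hFlim⟩ := exists_measurable_extension (X := X)
  refine ⟨P.map F, Measure.isProbabilityMeasure_map hF.aemeasurable, fun t => ?_⟩
  have heval : Measurable (rayEval t : RaySpace X → X) :=
    (measurable_pi_apply t).comp measurable_subtype_coe
  rw [Measure.map_map heval hF]
  obtain ⟨u, hu⟩ := exists_seq_nnrat_tendsto t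
  have hu' : Tendsto (fun n => (u n : ℝ≥0)) atTop (𝓝 t) := NNReal.tendsto_coe.1 hu
  have hcont : Continuous fun s : ℝ≥0 => ENNReal.ofReal ((v * dist s t) ^ 2) :=
    ENNReal.continuous_ofReal.comp (by fun_prop)
  have hcost := (hcont.tendsto t).comp hu'
  rw [dist_self, mul_zero, zero_pow two_ne_zero, ENNReal.ofReal_zero] at hcost
  refine map_eq_of_tendsto_of_W2cost (Y := fun n x => x (u n)) (fun n => by fun_prop)
    (heval.comp hF) ?_ ?_ ?_
  · filter_upwards [hgeo] with x hx
    exact hFlim x hx t u hu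
  · refine hcost.congr fun n => ?_
    rw [hmarg, W2cost_eq_ofReal, hray]
    rfl
  · refine hcost.congr fun n => ?_
    rw [hmarg, W2cost_eq_ofReal, hray, dist_comm]
    rfl

end
end
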